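/- (Sharpness and absence of extremals in the multilinear Pitt inequality.) Let m,n ≥ 1, 0 < α_k < n, α = Σ α_k with (m−1)n < α < mn, β = α − (m−1)n, and let C_β = π^{−(m−1)n/2 + α} · Π_{k=1}^m [Γ((n−α_k)/2)/Γ(α_k/2)] · [Γ(β/2)/Γ((n−β)/2)] · [Γ((n−β)/4)/Γ((n+β)/4)]². Then: (i) C_β is the least constant C such that ∫_{ℝ^n} |x|^{−β} |f(x,…,x)|² dx ≤ C · Λ(f; α_1,…,α_m) for all f ∈ 𝒮(ℝ^{mn}), i.e. the supremum over nonzero Schwartz f of the ratio of the left side to Λ(f; α_1,…,α_m) equals C_β; and (ii) no extremals exist: for every nonzero f ∈ 𝒮(ℝ^{mn}) the inequality is strict. -/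

import Mathlib

open MeasureTheory Real
open scoped ENNReal InnerProductSpace

noncomputable section

/-- Fourier transform with kernel `e^{2πi x·ξ}` on `(ℝ^n)^m`. -/
def fourierM {m n : ℕ} (f : (Fin m → EuclideanSpace ℝ (Fin n)) → ℂ)
    (ξ : Fin m → EuclideanSpace ℝ (Fin n)) : ℂ :=
  ∫ x, Complex.exp (2 * Real.pi * Complex.I * ((∑ k, ⟪x k, ξ k⟫_ℝ : ℝ) : ℂ)) * f x

/-- The multilinear fractional Dirichlet form
`Λ(f; α_1, …, α_m) = ∫ Π_k |ξ_k|^{α_k} |f̂(ξ)|² dξ`. -/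
def LamM {m n : ℕ} (f : (Fin m → EuclideanSpace ℝ (Fin n)) → ℂ)
    (α : Fin m → ℝ) : ℝ≥0∞ :=
  ∫⁻ ξ, (∏ k, ENNReal.ofReal (‖ξ k‖ ^ α k)) * (‖fourierM f ξ‖₊ : ℝ≥0∞) ^ (2 : ℕ)

/-- Left-hand side of the multilinear Pitt inequality:
the weighted square integral of the diagonal trace. -/
def pittLHS {m n : ℕ} (f : (Fin m → EuclideanSpace ℝ (Fin n)) → ℂ) (β : ℝ) : ℝ≥0∞ :=
  ∫⁻ x : EuclideanSpace ℝ (Fin n),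
    ENNReal.ofReal (‖x‖ ^ (-β)) * (‖f (fun _ => x)‖₊ : ℝ≥0∞) ^ (2 : ℕ)

section Auxiliary

open Set Filter Topology
open scoped FourierTransform ComplexConjugate

/-- Gamma integral as a Lebesgue integral. -/
theorem lintegral_rpow_mul_exp_neg_mul_Ioi {a c : ℝ} (ha : 0 < a) (hc : 0 < c) :
    ∫⁻ t in Ioi (0 : ℝ), ENNReal.ofReal (t ^ (a - 1) * exp (-(c * t))) =
      ENNReal.ofReal (Gamma a * c ^ (-a)) := by
  rw [← ofReal_integral_eq_lintegral_ofReal]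
  · rw [Real.integral_rpow_mul_exp_neg_mul_Ioi ha hc]
    congr 1
    rw [one_div, inv_rpow hc.le, rpow_neg hc.le, mul_comm]
  · have := integrableOn_rpow_mul_exp_neg_mul_rpow (p := 1) (s := a - 1) (b := c)
      (by linarith) one_pos hc
    simpa [IntegrableOn, neg_mul] using this
  · filter_upwards [self_mem_ae_restrict measurableSet_Ioi] with t ht
    have : (0 : ℝ) < t := ht
    simp only [Pi.zero_apply]; positivity

/-- The inverted Gamma integral. -/
theorem lintegral_rpow_mul_exp_neg_div_Ioi {a c : ℝ} (ha : 0 < a) (hc : 0 < c) :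
    ∫⁻ t in Ioi (0 : ℝ), ENNReal.ofReal (t ^ (-a - 1) * exp (-(c / t))) =
      ENNReal.ofReal (Gamma a * c ^ (-a)) := by
  have h1 : ∫ t in Ioi (0 : ℝ), t ^ (-a - 1) * exp (-(c / t)) = Gamma a * c ^ (-a) := by
    rw [show Gamma a * c ^ (-a) = (1 / c) ^ a * Gamma a by
      rw [one_div, inv_rpow hc.le, rpow_neg hc.le, mul_comm],
      ← Real.integral_rpow_mul_exp_neg_mul_Ioi ha hc,
      ← integral_comp_rpow_Ioi (fun t : ℝ => t ^ (a - 1) * exp (-(c * t))) (p := -1) (by norm_num)]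
    refine setIntegral_congr_fun measurableSet_Ioi fun t ht => ?_
    have ht : (0 : ℝ) < t := ht
    simp only [abs_neg, abs_one, one_mul, smul_eq_mul]
    rw [← rpow_mul ht.le, ← mul_assoc, ← rpow_add ht, rpow_neg_one, div_eq_mul_inv]
    ring_nf
  rw [← ofReal_integral_eq_lintegral_ofReal, h1]
  · refine Integrable.of_integral_ne_zero ?_
    rw [h1]
    have := Gamma_pos_of_pos ha
    positivity
  · filter_upwards [self_mem_ae_restrict measurableSet_Ioi] with t ht
    have : (0 : ℝ) < t := ht
    simp only [Pi.zero_apply]; positivity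

/-- A Riesz kernel as a mixture of Gaussians. -/
theorem lintegral_rpow_mul_exp_neg_pi_mul_sq {a r : ℝ} (ha : 0 < a) (hr : 0 < r) :
    ∫⁻ t in Ioi (0 : ℝ), ENNReal.ofReal (t ^ (a / 2 - 1) * exp (-(π * r ^ 2 * t))) =
      ENNReal.ofReal (Gamma (a / 2) * π ^ (-(a / 2))) * ENNReal.ofReal (r ^ (-a)) := by
  rw [lintegral_rpow_mul_exp_neg_mul_Ioi (by positivity) (by positivity),
    ← ENNReal.ofReal_mul (by have := Gamma_pos_of_pos (half_pos ha); positivity),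
    mul_rpow pi_pos.le (by positivity), ← rpow_natCast, ← rpow_mul hr.le]
  congr 1
  push_cast
  ring_nf

theorem lintegral_rpow_mul_exp_neg_pi_mul_sq_div {a r : ℝ} (ha : 0 < a) (hr : 0 < r) :
    ∫⁻ t in Ioi (0 : ℝ), ENNReal.ofReal (t ^ (-(a / 2) - 1) * exp (-(π * r ^ 2 / t))) =
      ENNReal.ofReal (Gamma (a / 2) * π ^ (-(a / 2))) * ENNReal.ofReal (r ^ (-a)) := by
  rw [lintegral_rpow_mul_exp_neg_div_Ioi (by positivity) (by positivity),
    ← ENNReal.ofReal_mul (by have := Gamma_pos_of_pos (half_pos ha); positivity),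
    mul_rpow pi_pos.le (by positivity), ← rpow_natCast, ← rpow_mul hr.le]
  congr 1
  push_cast
  ring_nf

/-- The Beta integral over the half-line. -/
theorem lintegral_rpow_mul_one_add_rpow {p q : ℝ} (hp : 0 < p) (hq : 0 < q) :
    ∫⁻ r in Ioi (0 : ℝ), ENNReal.ofReal (r ^ (p - 1) * (1 + r) ^ (-(p + q))) =
      ENNReal.ofReal (Gamma p * Gamma q / Gamma (p + q)) := by
  have hpq := Gamma_pos_of_pos (add_pos hp hq)
  have hgp := Gamma_pos_of_pos hp
  have hgq := Gamma_pos_of_pos hq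
  have key : ENNReal.ofReal (Gamma (p + q)) *
      ∫⁻ r in Ioi (0 : ℝ), ENNReal.ofReal (r ^ (p - 1) * (1 + r) ^ (-(p + q))) =
      ENNReal.ofReal (Gamma p * Gamma q) := by
    rw [← lintegral_const_mul _ (by fun_prop)]
    calc _ = ∫⁻ r in Ioi (0 : ℝ), ∫⁻ s in Ioi (0 : ℝ),
          ENNReal.ofReal (r ^ (p - 1) * (s ^ (p + q - 1) * exp (-((1 + r) * s)))) := by
          refine setLIntegral_congr_fun measurableSet_Ioi fun r hr => ?_
          have hr : (0 : ℝ) < r := hr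
          have h2 := lintegral_rpow_mul_exp_neg_mul_Ioi (add_pos hp hq)
            (show 0 < 1 + r by positivity)
          simp_rw [ENNReal.ofReal_mul (show 0 ≤ r ^ (p - 1) by positivity)]
          rw [lintegral_const_mul _ (by fun_prop), h2, ENNReal.ofReal_mul hpq.le]
          ring
      _ = ∫⁻ s in Ioi (0 : ℝ), ∫⁻ r in Ioi (0 : ℝ),
          ENNReal.ofReal (r ^ (p - 1) * (s ^ (p + q - 1) * exp (-((1 + r) * s)))) :=
          lintegral_lintegral_swap (by fun_prop)
      _ = ∫⁻ s in Ioi (0 : ℝ), ENNReal.ofReal (Gamma p) *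
            ENNReal.ofReal (s ^ (q - 1) * exp (-(1 * s))) := by
          refine setLIntegral_congr_fun measurableSet_Ioi fun s hs => ?_
          have hs : (0 : ℝ) < s := hs
          have h2 := lintegral_rpow_mul_exp_neg_mul_Ioi hp hs
          have h3 : ∀ r : ℝ, ENNReal.ofReal (r ^ (p - 1) * (s ^ (p + q - 1) * exp (-((1 + r) * s))))
              = ENNReal.ofReal (s ^ (p + q - 1) * exp (-s)) *
                ENNReal.ofReal (r ^ (p - 1) * exp (-(s * r))) := by
            intro r
            rw [← ENNReal.ofReal_mul (by positivity)]
            congr 1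
            rw [show -((1 + r) * s) = -s + -(s * r) by ring, Real.exp_add]
            ring
          simp_rw [h3]
          rw [lintegral_const_mul _ (by fun_prop), h2, ← ENNReal.ofReal_mul (by positivity),
            ← ENNReal.ofReal_mul (by positivity)]
          congr 1
          rw [show q - 1 = (p + q - 1) + -p by ring, rpow_add hs]
          ring_nf
      _ = _ := by
          rw [lintegral_const_mul _ (by fun_prop), lintegral_rpow_mul_exp_neg_mul_Ioi hq one_pos,
            ← ENNReal.ofReal_mul hgp.le]
          simp
  rw [ENNReal.ofReal_div_of_pos hpq, ← key, mul_comm, ENNReal.mul_div_cancel_right]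
  · simpa using hpq
  · simp

theorem lintegral_eq_rpow_mul_lintegral_comp_smul {V : Type*} [NormedAddCommGroup V]
    [NormedSpace ℝ V] [FiniteDimensional ℝ V] [MeasurableSpace V] [BorelSpace V] (μ : Measure V)
    [μ.IsAddHaarMeasure] (f : V → ℝ≥0∞) {r : ℝ} (hr : 0 < r) :
    ∫⁻ y, f y ∂μ = ENNReal.ofReal (r ^ (Module.finrank ℝ V : ℝ)) * ∫⁻ y, f (r • y) ∂μ := by
  have h : MeasurableEmbedding (fun y : V => r • y) :=
    (Homeomorph.smulOfNeZero r hr.ne').measurableEmbedding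
  rw [← h.lintegral_map, Measure.map_addHaar_smul μ hr.ne', lintegral_smul_measure, smul_eq_mul,
    ← mul_assoc, ← ENNReal.ofReal_mul (by positivity), abs_of_pos (by positivity), rpow_natCast,
    mul_inv_cancel₀ (by positivity)]
  simp

theorem setLIntegral_Ioi_eq_mul_comp_mul (f : ℝ → ℝ≥0∞) {t : ℝ} (ht : 0 < t) :
    ∫⁻ s in Ioi (0 : ℝ), f s = ENNReal.ofReal t * ∫⁻ r in Ioi (0 : ℝ), f (t * r) := by
  rw [← lintegral_indicator measurableSet_Ioi, ← lintegral_indicator measurableSet_Ioi,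
    lintegral_eq_rpow_mul_lintegral_comp_smul volume _ ht]
  simp only [Module.finrank_self, Nat.cast_one, rpow_one, smul_eq_mul]
  congr 1
  refine lintegral_congr fun r => ?_
  simp [indicator, ht]

theorem lintegral_exp_neg_pi_mul_sq {n : ℕ} {t : ℝ} (ht : 0 < t) :
    ∫⁻ y : EuclideanSpace ℝ (Fin n), ENNReal.ofReal (exp (-(π * ‖y‖ ^ 2 * t))) =
      ENNReal.ofReal (t ^ (-(n / 2 : ℝ))) := by
  have h := GaussianFourier.integral_rexp_neg_mul_sq_norm (V := EuclideanSpace ℝ (Fin n))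
    (b := π * t) (by positivity)
  have h2 : ∀ y : EuclideanSpace ℝ (Fin n), -(π * ‖y‖ ^ 2 * t) = -(π * t) * ‖y‖ ^ 2 := fun y => by
    ring
  have h3 : (π / (π * t)) ^ (Module.finrank ℝ (EuclideanSpace ℝ (Fin n)) / 2 : ℝ) =
      t ^ (-(n / 2 : ℝ)) := by
    rw [finrank_euclideanSpace_fin, rpow_neg ht.le, ← inv_rpow ht.le]
    congr 1
    field_simp
  simp_rw [h2]
  rw [← ofReal_integral_eq_lintegral_ofReal, h, h3]
  · refine Integrable.of_integral_ne_zero ?_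
    rw [h, h3]; positivity
  · exact Filter.Eventually.of_forall fun y => by simp only [Pi.zero_apply]; positivity

theorem lintegral_exp_neg_pi_mul_exp_neg_pi {n : ℕ} {t s : ℝ} (ht : 0 < t) (hs : 0 < s)
    (x : EuclideanSpace ℝ (Fin n)) :
    ∫⁻ y : EuclideanSpace ℝ (Fin n), ENNReal.ofReal (exp (-(π * ‖y‖ ^ 2 * t))) *
        ENNReal.ofReal (exp (-(π * ‖x - y‖ ^ 2 * s))) =
      ENNReal.ofReal ((t + s) ^ (-(n / 2 : ℝ)) * exp (-(π * ‖x‖ ^ 2 * (t * s / (t + s))))) := by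
  have h : ∀ y : EuclideanSpace ℝ (Fin n), ENNReal.ofReal (exp (-(π * ‖y‖ ^ 2 * t))) *
        ENNReal.ofReal (exp (-(π * ‖x - y‖ ^ 2 * s))) =
      ENNReal.ofReal (exp (-(π * ‖y - (s / (t + s)) • x‖ ^ 2 * (t + s)))) *
        ENNReal.ofReal (exp (-(π * ‖x‖ ^ 2 * (t * s / (t + s))))) := by
    intro y
    rw [← ENNReal.ofReal_mul (by positivity), ← ENNReal.ofReal_mul (by positivity),
      ← Real.exp_add, ← Real.exp_add]
    congr 2
    rw [norm_sub_sq_real, norm_sub_sq_real, norm_smul, inner_smul_right, real_inner_comm,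
      norm_of_nonneg (by positivity)]
    field_simp
    ring
  simp_rw [h]
  rw [lintegral_mul_const _ (by fun_prop), lintegral_sub_right_eq_self
    (fun y : EuclideanSpace ℝ (Fin n) => ENNReal.ofReal (exp (-(π * ‖y‖ ^ 2 * (t + s))))),
    lintegral_exp_neg_pi_mul_sq (by positivity), ← ENNReal.ofReal_mul (by positivity)]

/-- The constant in the composition formula for two Riesz kernels. -/
def rieszConst (n : ℕ) (a b : ℝ) : ℝ :=
  π ^ (n / 2 : ℝ) * (Gamma ((n - a) / 2) * Gamma ((n - b) / 2) * Gamma ((a + b - n) / 2)) /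
    (Gamma (a / 2) * Gamma (b / 2) * Gamma ((2 * n - a - b) / 2))

theorem lintegral_Ioi_Ioi_gaussian_mixture {n : ℕ} {a b : ℝ} (ha : a < n) (hb : b < n)
    (hab : n < a + b) {ρ : ℝ} (hρ : 0 < ρ) :
    ∫⁻ t in Ioi (0 : ℝ), ∫⁻ s in Ioi (0 : ℝ), ENNReal.ofReal (t ^ (a / 2 - 1) *
        (s ^ (b / 2 - 1) * ((t + s) ^ (-(n / 2 : ℝ)) * exp (-(ρ * (t * s / (t + s))))))) =
      ENNReal.ofReal (Gamma ((a + b - n) / 2) * ρ ^ (-((a + b - n) / 2)) *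
        (Gamma ((n - a) / 2) * Gamma ((n - b) / 2) / Gamma ((2 * n - a - b) / 2))) := by
  have hg := Gamma_pos_of_pos (show 0 < (a + b - n) / 2 by linarith)
  calc _ = ∫⁻ t in Ioi (0 : ℝ), ∫⁻ r in Ioi (0 : ℝ), ENNReal.ofReal
        ((r ^ (b / 2 - 1) * (1 + r) ^ (-(n / 2 : ℝ))) *
          (t ^ ((a + b - n) / 2 - 1) * exp (-(ρ * (r / (1 + r)) * t)))) := by
        refine setLIntegral_congr_fun measurableSet_Ioi fun t ht => ?_
        have ht : (0 : ℝ) < t := ht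
        rw [setLIntegral_Ioi_eq_mul_comp_mul _ ht, ← lintegral_const_mul _ (by fun_prop)]
        refine setLIntegral_congr_fun measurableSet_Ioi fun r hr => ?_
        have hr : (0 : ℝ) < r := hr
        rw [← ENNReal.ofReal_mul ht.le]
        congr 1
        rw [mul_rpow ht.le hr.le, show t + t * r = t * (1 + r) by ring,
          mul_rpow ht.le (by positivity),
          show t * (t * r) / (t * (1 + r)) = r / (1 + r) * t by field_simp,
          show (a + b - n) / 2 - 1 = 1 + (a / 2 - 1) + (b / 2 - 1) + -(n / 2 : ℝ) by ring,
          rpow_add ht, rpow_add ht, rpow_add ht, rpow_one]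
        ring_nf
    _ = ∫⁻ r in Ioi (0 : ℝ), ∫⁻ t in Ioi (0 : ℝ), ENNReal.ofReal
        ((r ^ (b / 2 - 1) * (1 + r) ^ (-(n / 2 : ℝ))) *
          (t ^ ((a + b - n) / 2 - 1) * exp (-(ρ * (r / (1 + r)) * t)))) :=
        lintegral_lintegral_swap (by fun_prop)
    _ = ∫⁻ r in Ioi (0 : ℝ), ENNReal.ofReal (Gamma ((a + b - n) / 2) * ρ ^ (-((a + b - n) / 2))) *
        ENNReal.ofReal (r ^ ((n - a) / 2 - 1) * (1 + r) ^ (-((n - a) / 2 + (n - b) / 2))) := by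
        refine setLIntegral_congr_fun measurableSet_Ioi fun r hr => ?_
        have hr : (0 : ℝ) < r := hr
        simp_rw [ENNReal.ofReal_mul (show 0 ≤ r ^ (b / 2 - 1) * (1 + r) ^ (-(n / 2 : ℝ)) by
          positivity)]
        rw [lintegral_const_mul _ (by fun_prop),
          lintegral_rpow_mul_exp_neg_mul_Ioi (by linarith) (by positivity),
          ← ENNReal.ofReal_mul (by positivity), ← ENNReal.ofReal_mul (by positivity)]
        congr 1
        rw [mul_rpow hρ.le (by positivity), div_rpow hr.le (by positivity),
          show (n - a) / 2 - 1 = (b / 2 - 1) + -((a + b - n) / 2) by ring, rpow_add hr,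
          show -((n - a) / 2 + (n - b) / 2) = -(n / 2 : ℝ) - -((a + b - n) / 2) by ring,
          rpow_sub (by positivity : 0 < 1 + r)]
        ring
    _ = _ := by
        rw [lintegral_const_mul _ (by fun_prop),
          lintegral_rpow_mul_one_add_rpow (by linarith) (by linarith),
          ← ENNReal.ofReal_mul (by positivity)]
        congr 5
        ring

/-- Composition of two Riesz kernels. -/
theorem lintegral_riesz_mul_riesz {n : ℕ} [NeZero n] {a b : ℝ} (ha0 : 0 < a) (ha : a < n)
    (hb0 : 0 < b) (hb : b < n) (hab : n < a + b) {x : EuclideanSpace ℝ (Fin n)} (hx : x ≠ 0) :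
    ∫⁻ y : EuclideanSpace ℝ (Fin n), ENNReal.ofReal (‖y‖ ^ (-a)) *
        ENNReal.ofReal (‖x - y‖ ^ (-b)) =
      ENNReal.ofReal (rieszConst n a b * ‖x‖ ^ (n - a - b)) := by
  have hga := Gamma_pos_of_pos (half_pos ha0)
  have hgb := Gamma_pos_of_pos (half_pos hb0)
  have hgab := Gamma_pos_of_pos (show 0 < (a + b - n) / 2 by linarith)
  have hgna := Gamma_pos_of_pos (show 0 < (n - a) / 2 by linarith)
  have hgnb := Gamma_pos_of_pos (show 0 < (n - b) / 2 by linarith)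
  have hg2 := Gamma_pos_of_pos (show 0 < (2 * n - a - b) / 2 by linarith)
  have hxn : 0 < ‖x‖ := norm_pos_iff.2 hx
  set ca := Gamma (a / 2) * π ^ (-(a / 2)) with hca
  set cb := Gamma (b / 2) * π ^ (-(b / 2)) with hcb
  have hca0 : 0 < ca := by positivity
  have hcb0 : 0 < cb := by positivity
  have key : ENNReal.ofReal (ca * cb) * ∫⁻ y : EuclideanSpace ℝ (Fin n),
      ENNReal.ofReal (‖y‖ ^ (-a)) * ENNReal.ofReal (‖x - y‖ ^ (-b)) =
      ENNReal.ofReal (Gamma ((a + b - n) / 2) * (π * ‖x‖ ^ 2) ^ (-((a + b - n) / 2)) *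
        (Gamma ((n - a) / 2) * Gamma ((n - b) / 2) / Gamma ((2 * n - a - b) / 2))) := by
    rw [← lintegral_const_mul _ (by fun_prop)]
    calc _ = ∫⁻ y : EuclideanSpace ℝ (Fin n), ∫⁻ t in Ioi (0 : ℝ), ∫⁻ s in Ioi (0 : ℝ),
          ENNReal.ofReal (t ^ (a / 2 - 1) * exp (-(π * ‖y‖ ^ 2 * t))) *
          ENNReal.ofReal (s ^ (b / 2 - 1) * exp (-(π * ‖x - y‖ ^ 2 * s))) := by
          refine lintegral_congr_ae ?_
          filter_upwards [Measure.ae_ne volume (0 : EuclideanSpace ℝ (Fin n)),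
            Measure.ae_ne volume x] with y hy0 hyx
          have h1 : ∀ t : ℝ, ∫⁻ s in Ioi (0 : ℝ),
              ENNReal.ofReal (t ^ (a / 2 - 1) * exp (-(π * ‖y‖ ^ 2 * t))) *
              ENNReal.ofReal (s ^ (b / 2 - 1) * exp (-(π * ‖x - y‖ ^ 2 * s))) =
              ENNReal.ofReal (t ^ (a / 2 - 1) * exp (-(π * ‖y‖ ^ 2 * t))) *
              ∫⁻ s in Ioi (0 : ℝ),
                ENNReal.ofReal (s ^ (b / 2 - 1) * exp (-(π * ‖x - y‖ ^ 2 * s))) := fun t =>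
            lintegral_const_mul _ (by fun_prop)
          simp_rw [h1]
          rw [lintegral_mul_const _ (by fun_prop),
            lintegral_rpow_mul_exp_neg_pi_mul_sq ha0 (norm_pos_iff.2 hy0),
            lintegral_rpow_mul_exp_neg_pi_mul_sq hb0 (norm_pos_iff.2 (sub_ne_zero.2 hyx.symm)),
            ENNReal.ofReal_mul hca0.le]
          ring
      _ = ∫⁻ t in Ioi (0 : ℝ), ∫⁻ s in Ioi (0 : ℝ), ∫⁻ y : EuclideanSpace ℝ (Fin n),
          ENNReal.ofReal (t ^ (a / 2 - 1) * exp (-(π * ‖y‖ ^ 2 * t))) *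
          ENNReal.ofReal (s ^ (b / 2 - 1) * exp (-(π * ‖x - y‖ ^ 2 * s))) := by
          rw [lintegral_lintegral_swap]
          · refine lintegral_congr fun t => ?_
            rw [lintegral_lintegral_swap]
            fun_prop
          · refine Measurable.aemeasurable (Measurable.lintegral_prod_right ?_)
            fun_prop
      _ = ∫⁻ t in Ioi (0 : ℝ), ∫⁻ s in Ioi (0 : ℝ), ENNReal.ofReal (t ^ (a / 2 - 1) *
        (s ^ (b / 2 - 1) * ((t + s) ^ (-(n / 2 : ℝ)) *
          exp (-(π * ‖x‖ ^ 2 * (t * s / (t + s))))))) := by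
          refine setLIntegral_congr_fun measurableSet_Ioi fun t ht => ?_
          have ht : (0 : ℝ) < t := ht
          refine setLIntegral_congr_fun measurableSet_Ioi fun s hs => ?_
          have hs : (0 : ℝ) < s := hs
          have h1 : ∀ y : EuclideanSpace ℝ (Fin n),
              ENNReal.ofReal (t ^ (a / 2 - 1) * exp (-(π * ‖y‖ ^ 2 * t))) *
              ENNReal.ofReal (s ^ (b / 2 - 1) * exp (-(π * ‖x - y‖ ^ 2 * s))) =
              ENNReal.ofReal (t ^ (a / 2 - 1) * s ^ (b / 2 - 1)) *
              (ENNReal.ofReal (exp (-(π * ‖y‖ ^ 2 * t))) *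
              ENNReal.ofReal (exp (-(π * ‖x - y‖ ^ 2 * s)))) := by
            intro y
            simp only [ENNReal.ofReal_mul (show 0 ≤ t ^ (a / 2 - 1) by positivity),
              ENNReal.ofReal_mul (show 0 ≤ s ^ (b / 2 - 1) by positivity)]
            ring
          simp_rw [h1]
          rw [lintegral_const_mul _ (by fun_prop), lintegral_exp_neg_pi_mul_exp_neg_pi ht hs,
            ← ENNReal.ofReal_mul (by positivity), mul_assoc]
      _ = _ := lintegral_Ioi_Ioi_gaussian_mixture ha hb hab (by positivity)
  have h2 : ENNReal.ofReal (rieszConst n a b * ‖x‖ ^ (n - a - b)) =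
      ENNReal.ofReal (Gamma ((a + b - n) / 2) * (π * ‖x‖ ^ 2) ^ (-((a + b - n) / 2)) *
        (Gamma ((n - a) / 2) * Gamma ((n - b) / 2) / Gamma ((2 * n - a - b) / 2))) /
      ENNReal.ofReal (ca * cb) := by
    rw [← ENNReal.ofReal_div_of_pos (by positivity)]
    congr 1
    rw [mul_rpow pi_pos.le (by positivity), ← rpow_natCast ‖x‖ 2, ← rpow_mul hxn.le,
      show ((2 : ℕ) : ℝ) * -((a + b - n) / 2) = n - a - b by push_cast; ring, hca, hcb, rieszConst,
      show (n / 2 : ℝ) = -((a + b - n) / 2) - (-(a / 2) + -(b / 2)) by ring, rpow_sub pi_pos,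
      rpow_add pi_pos]
    field_simp
  rw [h2, ← key, mul_comm, ENNReal.mul_div_cancel_right]
  · simp only [ne_eq, ENNReal.ofReal_eq_zero, not_le]; positivity
  · simp

/-- The best constant in the diagonal Stein–Weiss inequality with kernel
`|x|^{-β/2} |x-y|^{β-n} |y|^{-β/2}`. -/
def steinWeissConst (n : ℕ) (β : ℝ) : ℝ := rieszConst n ((n + β) / 2) (n - β)

theorem rieszConst_pos {n : ℕ} {a b : ℝ} (ha0 : 0 < a) (ha : a < n)
    (hb0 : 0 < b) (hb : b < n) (hab : n < a + b) : 0 < rieszConst n a b := by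
  have hga := Gamma_pos_of_pos (half_pos ha0)
  have hgb := Gamma_pos_of_pos (half_pos hb0)
  have hgab := Gamma_pos_of_pos (show 0 < (a + b - n) / 2 by linarith)
  have hgna := Gamma_pos_of_pos (show 0 < (n - a) / 2 by linarith)
  have hgnb := Gamma_pos_of_pos (show 0 < (n - b) / 2 by linarith)
  have hg2 := Gamma_pos_of_pos (show 0 < (2 * n - a - b) / 2 by linarith)
  unfold rieszConst
  positivity

theorem steinWeissConst_pos {n : ℕ} {β : ℝ} (hβ0 : 0 < β) (hβn : β < n) :
    0 < steinWeissConst n β :=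
  rieszConst_pos (by linarith) (by linarith) (by linarith) (by linarith) (by linarith)

/-- The bilinear Riesz energy of `v`. -/
def rieszEnergy {n : ℕ} (β : ℝ) (v : EuclideanSpace ℝ (Fin n) → ℝ) : ℝ≥0∞ :=
  ∫⁻ x, ∫⁻ y, ENNReal.ofReal (v x * v y * ‖x - y‖ ^ (β - n))

/-- The deficit in the Schur test for the Stein–Weiss kernel. -/
def schurDeficit {n : ℕ} (β : ℝ) (v : EuclideanSpace ℝ (Fin n) → ℝ)
    (x y : EuclideanSpace ℝ (Fin n)) : ℝ :=
  1 / 2 * ‖x - y‖ ^ (β - n) * (‖x‖ ^ (-((n + β) / 2)) * ‖y‖ ^ (-((n + β) / 2))) *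
    (v x * ‖x‖ ^ ((n + β) / 2) - v y * ‖y‖ ^ ((n + β) / 2)) ^ 2

theorem schurDeficit_nonneg {n : ℕ} (β : ℝ) (v : EuclideanSpace ℝ (Fin n) → ℝ)
    (x y : EuclideanSpace ℝ (Fin n)) : 0 ≤ schurDeficit β v x y := by
  unfold schurDeficit; positivity

theorem measurable_schurDeficit {n : ℕ} (β : ℝ) {v : EuclideanSpace ℝ (Fin n) → ℝ}
    (hv : Measurable v) : Measurable (Function.uncurry (schurDeficit β v)) := by
  unfold schurDeficit Function.uncurry; fun_prop

theorem lintegral_riesz_weight {n : ℕ} [NeZero n] {β : ℝ} (hβ0 : 0 < β) (hβn : β < n)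
    {x : EuclideanSpace ℝ (Fin n)} (hx : x ≠ 0) :
    ∫⁻ y : EuclideanSpace ℝ (Fin n), ENNReal.ofReal (‖y‖ ^ (-((n + β) / 2)) *
      ‖x - y‖ ^ (β - n)) =
      ENNReal.ofReal (steinWeissConst n β * ‖x‖ ^ (β - (n + β) / 2)) := by
  have h := lintegral_riesz_mul_riesz (n := n) (a := (n + β) / 2) (b := n - β) (by linarith)
    (by linarith) (by linarith) (by linarith) (by linarith) hx
  rw [show (n : ℝ) - (n + β) / 2 - (n - β) = β - (n + β) / 2 by ring] at h
  rw [steinWeissConst, ← h]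
  refine lintegral_congr fun y => ?_
  rw [ENNReal.ofReal_mul (by positivity)]
  congr 3
  ring

theorem lintegral_lintegral_weighted_sq {n : ℕ} [NeZero n] {β : ℝ} (hβ0 : 0 < β) (hβn : β < n)
    {v : EuclideanSpace ℝ (Fin n) → ℝ} (hv : Measurable v) :
    ∫⁻ x, ∫⁻ y, ENNReal.ofReal (1 / 2 * (v x ^ 2 * ‖x‖ ^ ((n + β) / 2))) *
      ENNReal.ofReal (‖y‖ ^ (-((n + β) / 2)) * ‖x - y‖ ^ (β - n)) =
    ENNReal.ofReal (1 / 2) * (ENNReal.ofReal (steinWeissConst n β) *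
      ∫⁻ x, ENNReal.ofReal (‖x‖ ^ β * v x ^ 2)) := by
  have hN := steinWeissConst_pos hβ0 hβn
  rw [← lintegral_const_mul _ (by fun_prop), ← lintegral_const_mul _ (by fun_prop)]
  refine lintegral_congr_ae ?_
  filter_upwards [Measure.ae_ne volume (0 : EuclideanSpace ℝ (Fin n))] with x hx
  have hxn : 0 < ‖x‖ := norm_pos_iff.2 hx
  rw [lintegral_const_mul _ (by fun_prop), lintegral_riesz_weight hβ0 hβn hx,
    ← ENNReal.ofReal_mul (by positivity), ← ENNReal.ofReal_mul hN.le,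
    ← ENNReal.ofReal_mul (by positivity)]
  congr 1
  have : ‖x‖ ^ β = ‖x‖ ^ ((n + β) / 2) * ‖x‖ ^ (β - (n + β) / 2) := by
    rw [← rpow_add hxn]; ring_nf
  rw [this]
  ring

theorem mul_add_schurDeficit {n : ℕ} {β : ℝ} (v : EuclideanSpace ℝ (Fin n) → ℝ)
    {x y : EuclideanSpace ℝ (Fin n)} (hx : x ≠ 0) (hy : y ≠ 0) :
    v x * v y * ‖x - y‖ ^ (β - n) + schurDeficit β v x y =
      1 / 2 * (v x ^ 2 * ‖x‖ ^ ((n + β) / 2)) *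
        (‖y‖ ^ (-((n + β) / 2)) * ‖x - y‖ ^ (β - n)) +
      1 / 2 * (v y ^ 2 * ‖y‖ ^ ((n + β) / 2)) *
        (‖x‖ ^ (-((n + β) / 2)) * ‖y - x‖ ^ (β - n)) := by
  have hxn : 0 < ‖x‖ := norm_pos_iff.2 hx
  have hyn : 0 < ‖y‖ := norm_pos_iff.2 hy
  rw [schurDeficit, norm_sub_rev y x, rpow_neg hxn.le, rpow_neg hyn.le]
  have h1 : ‖x‖ ^ ((n + β) / 2) ≠ 0 := by positivity
  have h2 : ‖y‖ ^ ((n + β) / 2) ≠ 0 := by positivity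
  field_simp
  ring

theorem rieszEnergy_add_deficit {n : ℕ} [NeZero n] {β : ℝ} (hβ0 : 0 < β) (hβn : β < n)
    {v : EuclideanSpace ℝ (Fin n) → ℝ} (hv : Measurable v) (hv0 : ∀ x, 0 ≤ v x) :
    rieszEnergy β v + ∫⁻ x, ∫⁻ y, ENNReal.ofReal (schurDeficit β v x y) =
      ENNReal.ofReal (steinWeissConst n β) * ∫⁻ x, ENNReal.ofReal (‖x‖ ^ β * v x ^ 2) := by
  have hd := measurable_schurDeficit β hv
  have hm1 : Measurable (fun q : EuclideanSpace ℝ (Fin n) × EuclideanSpace ℝ (Fin n) =>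
      ENNReal.ofReal (v q.1 * v q.2 * ‖q.1 - q.2‖ ^ (β - n))) := by fun_prop
  have hm2 : Measurable (fun q : EuclideanSpace ℝ (Fin n) × EuclideanSpace ℝ (Fin n) =>
      ENNReal.ofReal (1 / 2 * (v q.1 ^ 2 * ‖q.1‖ ^ ((n + β) / 2))) *
      ENNReal.ofReal (‖q.2‖ ^ (-((n + β) / 2)) * ‖q.1 - q.2‖ ^ (β - n))) := by fun_prop
  have hsplit := lintegral_lintegral_weighted_sq hβ0 hβn hv
  calc _ = ∫⁻ x, ∫⁻ y, (ENNReal.ofReal (v x * v y * ‖x - y‖ ^ (β - n)) +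
        ENNReal.ofReal (schurDeficit β v x y)) := by
        rw [rieszEnergy, ← lintegral_add_left hm1.lintegral_prod_right']
        refine lintegral_congr fun x => ?_
        rw [lintegral_add_left (by fun_prop)]
    _ = ∫⁻ x, ∫⁻ y, (ENNReal.ofReal (1 / 2 * (v x ^ 2 * ‖x‖ ^ ((n + β) / 2))) *
          ENNReal.ofReal (‖y‖ ^ (-((n + β) / 2)) * ‖x - y‖ ^ (β - n)) +
        ENNReal.ofReal (1 / 2 * (v y ^ 2 * ‖y‖ ^ ((n + β) / 2))) *
          ENNReal.ofReal (‖x‖ ^ (-((n + β) / 2)) * ‖y - x‖ ^ (β - n))) := by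
        refine lintegral_congr_ae ?_
        filter_upwards [Measure.ae_ne volume (0 : EuclideanSpace ℝ (Fin n))] with x hx
        refine lintegral_congr_ae ?_
        filter_upwards [Measure.ae_ne volume (0 : EuclideanSpace ℝ (Fin n))] with y hy
        have := hv0 x
        have := hv0 y
        rw [← ENNReal.ofReal_add (by positivity) (schurDeficit_nonneg ..),
          mul_add_schurDeficit v hx hy, ENNReal.ofReal_add (by positivity) (by positivity),
          ENNReal.ofReal_mul (show 0 ≤ 1 / 2 * (v x ^ 2 * ‖x‖ ^ ((n + β) / 2)) by positivity),
          ENNReal.ofReal_mul (show 0 ≤ 1 / 2 * (v y ^ 2 * ‖y‖ ^ ((n + β) / 2)) by positivity)]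
    _ = ENNReal.ofReal (1 / 2) * (ENNReal.ofReal (steinWeissConst n β) *
          ∫⁻ x, ENNReal.ofReal (‖x‖ ^ β * v x ^ 2)) +
        ENNReal.ofReal (1 / 2) * (ENNReal.ofReal (steinWeissConst n β) *
          ∫⁻ x, ENNReal.ofReal (‖x‖ ^ β * v x ^ 2)) := by
        conv_rhs => rw [← hsplit]
        nth_rewrite 3 [lintegral_lintegral_swap hm2.aemeasurable]
        rw [← lintegral_add_left hm2.lintegral_prod_right']
        refine lintegral_congr fun x => ?_
        rw [lintegral_add_left (by fun_prop)]
    _ = _ := by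
        rw [← add_mul, ← ENNReal.ofReal_add (by norm_num) (by norm_num)]
        norm_num

theorem rieszEnergy_le {n : ℕ} [NeZero n] {β : ℝ} (hβ0 : 0 < β) (hβn : β < n)
    {v : EuclideanSpace ℝ (Fin n) → ℝ} (hv : Measurable v) (hv0 : ∀ x, 0 ≤ v x) :
    rieszEnergy β v ≤
      ENNReal.ofReal (steinWeissConst n β) * ∫⁻ x, ENNReal.ofReal (‖x‖ ^ β * v x ^ 2) := by
  rw [← rieszEnergy_add_deficit hβ0 hβn hv hv0]
  exact le_self_add

/-- Equality in the Stein–Weiss inequality forces `v` to be a multiple of `|x|^{-(n+β)/2}`. -/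
theorem rieszEnergy_lt_or_ae_eq {n : ℕ} [NeZero n] {β : ℝ} (hβ0 : 0 < β) (hβn : β < n)
    {v : EuclideanSpace ℝ (Fin n) → ℝ} (hv : Measurable v) (hv0 : ∀ x, 0 ≤ v x)
    (hfin : ∫⁻ x, ENNReal.ofReal (‖x‖ ^ β * v x ^ 2) ≠ ⊤) :
    rieszEnergy β v < ENNReal.ofReal (steinWeissConst n β) *
        ∫⁻ x, ENNReal.ofReal (‖x‖ ^ β * v x ^ 2) ∨
      ∃ c, ∀ᵐ x, v x * ‖x‖ ^ ((n + β) / 2) = c := by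
  by_cases h0 : ∫⁻ x, ∫⁻ y, ENNReal.ofReal (schurDeficit β v x y) = 0
  · right
    have hm : Measurable fun x => ∫⁻ y, ENNReal.ofReal (schurDeficit β v x y) :=
      Measurable.lintegral_prod_right' (f := fun q => ENNReal.ofReal (schurDeficit β v q.1 q.2))
        (measurable_schurDeficit β hv).ennreal_ofReal
    rw [lintegral_eq_zero_iff hm] at h0
    obtain ⟨x, hx, hx0⟩ :=
      (h0.and (Measure.ae_ne volume (0 : EuclideanSpace ℝ (Fin n)))).exists
    have hmx : Measurable fun y => ENNReal.ofReal (schurDeficit β v x y) :=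
      ((measurable_schurDeficit β hv).comp measurable_prodMk_left).ennreal_ofReal
    simp only [Pi.zero_apply] at hx
    rw [lintegral_eq_zero_iff hmx] at hx
    refine ⟨v x * ‖x‖ ^ ((n + β) / 2), ?_⟩
    filter_upwards [hx, Measure.ae_ne volume (0 : EuclideanSpace ℝ (Fin n)),
      Measure.ae_ne volume x] with y hy hy0 hyx
    have h1 : 0 < ‖x‖ := norm_pos_iff.2 hx0
    have h2 : 0 < ‖y‖ := norm_pos_iff.2 hy0
    have h3 : 0 < ‖x - y‖ := norm_pos_iff.2 (sub_ne_zero.2 hyx.symm)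
    simp only [Pi.zero_apply, ENNReal.ofReal_eq_zero] at hy
    have h4 := le_antisymm hy (schurDeficit_nonneg β v x y)
    rw [schurDeficit, mul_eq_zero, or_iff_right (by positivity), sq_eq_zero_iff] at h4
    linarith
  · left
    rw [← rieszEnergy_add_deficit hβ0 hβn hv hv0]
    refine ENNReal.lt_add_right ?_ h0
    refine ne_top_of_le_ne_top ?_ (rieszEnergy_le hβ0 hβn hv hv0)
    exact ENNReal.mul_ne_top ENNReal.ofReal_ne_top hfin

/-- The submultiplicative cutoff `min (r^ε) (r^{-ε})`. -/
def powCutoff (ε r : ℝ) : ℝ := min (r ^ ε) (r ^ (-ε))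

theorem powCutoff_nonneg (ε : ℝ) {r : ℝ} (hr : 0 ≤ r) : 0 ≤ powCutoff ε r :=
  le_min (by positivity) (by positivity)

theorem powCutoff_pos (ε : ℝ) {r : ℝ} (hr : 0 < r) : 0 < powCutoff ε r :=
  lt_min (by positivity) (by positivity)

theorem powCutoff_le_one {ε : ℝ} (hε : 0 ≤ ε) {r : ℝ} (hr : 0 < r) : powCutoff ε r ≤ 1 := by
  rcases le_total r 1 with h | h
  · exact (min_le_left _ _).trans (rpow_le_one hr.le h hε)
  · exact (min_le_right _ _).trans (rpow_le_one_of_one_le_of_nonpos h (by linarith))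

theorem powCutoff_mul_le (ε : ℝ) {r s : ℝ} (hr : 0 ≤ r) (hs : 0 ≤ s) :
    powCutoff ε r * powCutoff ε s ≤ powCutoff ε (r * s) := by
  have h1 := powCutoff_nonneg ε hr
  have h2 := powCutoff_nonneg ε hs
  refine le_min ?_ ?_
  · rw [mul_rpow hr hs]
    exact mul_le_mul (min_le_left _ _) (min_le_left _ _) h2 (by positivity)
  · rw [mul_rpow hr hs]
    exact mul_le_mul (min_le_right _ _) (min_le_right _ _) h2 (by positivity)

@[fun_prop]
theorem measurable_powCutoff (ε : ℝ) : Measurable (powCutoff ε) := by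
  unfold powCutoff; fun_prop

theorem tendsto_powCutoff {r : ℝ} (hr : 0 < r) :
    Tendsto (fun ε => powCutoff ε r) (𝓝 0) (𝓝 1) := by
  have : Continuous fun ε => powCutoff ε r := by
    unfold powCutoff
    exact (continuous_const_rpow hr.ne').min ((continuous_const_rpow hr.ne').comp continuous_neg)
  simpa [powCutoff] using this.tendsto 0

/-- Near-extremals of the Stein–Weiss inequality. -/
def steinWeissTest {n : ℕ} (β ε : ℝ) (x : EuclideanSpace ℝ (Fin n)) : ℝ :=
  ‖x‖ ^ (-((n + β) / 2)) * powCutoff ε ‖x‖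

theorem steinWeissTest_nonneg {n : ℕ} (β ε : ℝ) (x : EuclideanSpace ℝ (Fin n)) :
    0 ≤ steinWeissTest β ε x :=
  mul_nonneg (by positivity) (powCutoff_nonneg ε (norm_nonneg x))

@[fun_prop]
theorem measurable_steinWeissTest {n : ℕ} (β ε : ℝ) :
    Measurable (steinWeissTest (n := n) β ε) := by
  unfold steinWeissTest; fun_prop

/-- The regularised Stein–Weiss constant. -/
def cutoffMass {n : ℕ} (β ε : ℝ) (e : EuclideanSpace ℝ (Fin n)) : ℝ≥0∞ :=
  ∫⁻ z, ENNReal.ofReal (powCutoff ε ‖z‖ * (‖z‖ ^ (-((n + β) / 2)) * ‖e - z‖ ^ (β - n)))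

theorem cutoffMass_eq {n : ℕ} (β ε : ℝ) {e u : EuclideanSpace ℝ (Fin n)} (h : ‖e‖ = ‖u‖) :
    cutoffMass β ε e = cutoffMass β ε u := by
  set T := (ℝ ∙ (e - u))ᗮ.reflection with hT
  have hTe : T e = u := Submodule.reflection_sub h
  symm
  rw [cutoffMass, cutoffMass, ← T.measurePreserving.lintegral_comp_emb
    T.toHomeomorph.measurableEmbedding]
  refine lintegral_congr fun z => ?_
  rw [← hTe, ← map_sub, T.norm_map, T.norm_map]

theorem tendsto_cutoffMass {n : ℕ} [NeZero n] {β : ℝ} (hβ0 : 0 < β) (hβn : β < n)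
    {e : EuclideanSpace ℝ (Fin n)} (he : ‖e‖ = 1) {ε : ℕ → ℝ} (hε0 : ∀ k, 0 ≤ ε k)
    (hε : Tendsto ε atTop (𝓝 0)) :
    Tendsto (fun k => cutoffMass β (ε k) e) atTop
      (𝓝 (ENNReal.ofReal (steinWeissConst n β))) := by
  have he0 : e ≠ 0 := by rw [← norm_ne_zero_iff, he]; norm_num
  have hN := lintegral_riesz_weight hβ0 hβn he0
  rw [he, one_rpow, mul_one] at hN
  rw [← hN]
  refine tendsto_lintegral_of_dominated_convergence
    (fun z => ENNReal.ofReal (‖z‖ ^ (-((n + β) / 2)) * ‖e - z‖ ^ (β - n))) (fun k => by fun_prop)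
    (fun k => ?_) (by rw [hN]; exact ENNReal.ofReal_ne_top) ?_
  · filter_upwards [Measure.ae_ne volume (0 : EuclideanSpace ℝ (Fin n))] with z hz
    refine ENNReal.ofReal_le_ofReal (mul_le_of_le_one_left (by positivity) ?_)
    exact powCutoff_le_one (hε0 k) (norm_pos_iff.2 hz)
  · filter_upwards [Measure.ae_ne volume (0 : EuclideanSpace ℝ (Fin n))] with z hz
    refine ENNReal.tendsto_ofReal ?_
    simpa using ((tendsto_powCutoff (norm_pos_iff.2 hz)).comp hε).mul_const
      (‖z‖ ^ (-((n + β) / 2)) * ‖e - z‖ ^ (β - n))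

theorem mul_cutoffMass_le_rieszEnergy {n : ℕ} [NeZero n] (β ε : ℝ)
    {e : EuclideanSpace ℝ (Fin n)} (he : ‖e‖ = 1) :
    cutoffMass β ε e * ∫⁻ x : EuclideanSpace ℝ (Fin n),
      ENNReal.ofReal (‖x‖ ^ β * steinWeissTest β ε x ^ 2) ≤
    rieszEnergy (n := n) β (steinWeissTest β ε) := by
  rw [← lintegral_const_mul _ (by fun_prop), rieszEnergy]
  refine lintegral_mono_ae ?_
  filter_upwards [Measure.ae_ne volume (0 : EuclideanSpace ℝ (Fin n))] with x hx
  have hxn : 0 < ‖x‖ := norm_pos_iff.2 hx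
  have hc := powCutoff_nonneg ε hxn.le
  have hv := steinWeissTest_nonneg β ε x
  set u : EuclideanSpace ℝ (Fin n) := ‖x‖⁻¹ • x with hu
  have hu1 : ‖e‖ = ‖u‖ := by
    rw [he, hu, norm_smul, norm_inv, norm_norm, inv_mul_cancel₀ hxn.ne']
  have hxu : x = ‖x‖ • u := by rw [hu, smul_smul, mul_inv_cancel₀ hxn.ne', one_smul]
  rw [cutoffMass_eq β ε hu1, cutoffMass, mul_comm, ← lintegral_const_mul _ (by fun_prop),
    lintegral_eq_rpow_mul_lintegral_comp_smul volume
      (fun y => ENNReal.ofReal (steinWeissTest β ε x * _ * _)) hxn, finrank_euclideanSpace_fin,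
    ← lintegral_const_mul _ (by fun_prop)]
  refine lintegral_mono fun z => ?_
  have hcz := powCutoff_nonneg ε (norm_nonneg z)
  simp only
  rw [← ENNReal.ofReal_mul (by positivity), ← ENNReal.ofReal_mul (by positivity)]
  refine ENNReal.ofReal_le_ofReal ?_
  have h1 : ‖x - ‖x‖ • z‖ = ‖x‖ * ‖u - z‖ := by
    conv_lhs => rw [hxu, norm_smul, norm_norm, ← hu1, he, mul_one, ← smul_sub, norm_smul, norm_norm]
  have h2 : ‖‖x‖ • z‖ = ‖x‖ * ‖z‖ := by rw [norm_smul, norm_norm]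
  have h3 : ‖x‖ ^ β * steinWeissTest β ε x ^ 2 =
      ‖x‖ ^ (n : ℝ) * (steinWeissTest β ε x * (‖x‖ ^ (-((n + β) / 2)) * ‖x‖ ^ (β - n))) *
        powCutoff ε ‖x‖ := by
    have : ‖x‖ ^ β = ‖x‖ ^ (n : ℝ) * ‖x‖ ^ (β - n) := by rw [← rpow_add hxn]; ring_nf
    rw [this, sq]
    nth_rewrite 2 [steinWeissTest]
    ring
  rw [h1, h3, mul_rpow hxn.le (norm_nonneg _)]
  nth_rewrite 3 [steinWeissTest]
  rw [h2, mul_rpow hxn.le (norm_nonneg _)]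
  calc _ = ‖x‖ ^ (n : ℝ) * (steinWeissTest β ε x * (‖x‖ ^ (-((n + β) / 2)) *
        ‖x‖ ^ (β - n))) * (‖z‖ ^ (-((n + β) / 2)) * ‖u - z‖ ^ (β - n)) *
        (powCutoff ε ‖x‖ * powCutoff ε ‖z‖) := by ring
    _ ≤ ‖x‖ ^ (n : ℝ) * (steinWeissTest β ε x * (‖x‖ ^ (-((n + β) / 2)) *
        ‖x‖ ^ (β - n))) * (‖z‖ ^ (-((n + β) / 2)) * ‖u - z‖ ^ (β - n)) *
        powCutoff ε (‖x‖ * ‖z‖) := by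
        gcongr
        exact powCutoff_mul_le ε hxn.le (norm_nonneg z)
    _ = _ := by ring

theorem lintegral_steinWeissTest_ne_top {n : ℕ} [NeZero n] {β ε : ℝ} (hε : 0 < ε)
    (hε4 : 4 * ε < 1) :
    ∫⁻ x : EuclideanSpace ℝ (Fin n),
      ENNReal.ofReal (‖x‖ ^ β * steinWeissTest β ε x ^ 2) ≠ ⊤ := by
  have hn : (1 : ℝ) ≤ n := by exact_mod_cast NeZero.one_le
  obtain ⟨e, he⟩ := exists_norm_eq (EuclideanSpace ℝ (Fin n)) (zero_le_one' ℝ)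
  have he0 : e ≠ 0 := by rw [← norm_ne_zero_iff, he]; norm_num
  have h := lintegral_riesz_mul_riesz (n := n) (a := n - 2 * ε) (b := 4 * ε) (by linarith)
    (by linarith) (by linarith) (by linarith) (by linarith) he0
  refine ne_top_of_le_ne_top (b := ENNReal.ofReal (2 ^ (4 * ε)) *
    ENNReal.ofReal (rieszConst n (n - 2 * ε) (4 * ε) * ‖e‖ ^ (n - (n - 2 * ε) - 4 * ε)))
    (by finiteness) ?_
  rw [← h, ← lintegral_const_mul _ (by fun_prop)]
  refine lintegral_mono_ae ?_
  filter_upwards [Measure.ae_ne volume (0 : EuclideanSpace ℝ (Fin n)),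
    Measure.ae_ne volume e] with y hy hye
  have hyn : 0 < ‖y‖ := norm_pos_iff.2 hy
  have hey : 0 < ‖e - y‖ := norm_pos_iff.2 (sub_ne_zero.2 hye.symm)
  have htri : ‖e - y‖ ≤ 1 + ‖y‖ := (norm_sub_le _ _).trans_eq (by rw [he])
  have hc := powCutoff_nonneg ε hyn.le
  rw [← ENNReal.ofReal_mul (by positivity), ← ENNReal.ofReal_mul (by positivity)]
  refine ENNReal.ofReal_le_ofReal ?_
  have h1 : ‖y‖ ^ β * steinWeissTest β ε y ^ 2 = ‖y‖ ^ (-(n : ℝ)) * powCutoff ε ‖y‖ ^ 2 := by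
    rw [steinWeissTest, mul_pow, ← rpow_natCast, ← rpow_mul hyn.le, ← mul_assoc, ← rpow_add hyn]
    push_cast
    ring_nf
  have h2 : ∀ r : ℝ, 0 < r → ‖e - y‖ ≤ 2 * r → r ^ (-(4 * ε)) ≤
      2 ^ (4 * ε) * ‖e - y‖ ^ (-(4 * ε)) := by
    intro r hr hle
    have h3 : (2 * r) ^ (-(4 * ε)) ≤ ‖e - y‖ ^ (-(4 * ε)) :=
      rpow_le_rpow_of_nonpos hey hle (by linarith)
    rw [mul_rpow zero_le_two hr.le, rpow_neg zero_le_two, inv_mul_le_iff₀ (by positivity)] at h3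
    exact h3
  rw [h1]
  have hsq : powCutoff ε ‖y‖ ^ 2 ≤ ‖y‖ ^ (2 * ε) ∧ powCutoff ε ‖y‖ ^ 2 ≤ ‖y‖ ^ (-(2 * ε)) := by
    constructor
    · refine (pow_le_pow_left₀ hc (min_le_left _ _) 2).trans_eq ?_
      rw [← rpow_natCast, ← rpow_mul hyn.le]
      push_cast
      ring_nf
    · refine (pow_le_pow_left₀ hc (min_le_right _ _) 2).trans_eq ?_
      rw [← rpow_natCast, ← rpow_mul hyn.le]
      push_cast
      ring_nf
  rcases le_total ‖y‖ 1 with hle | hle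
  · calc _ ≤ ‖y‖ ^ (-(n : ℝ)) * ‖y‖ ^ (2 * ε) := by gcongr; exact hsq.1
      _ = ‖y‖ ^ (-(n - 2 * ε)) * 1 ^ (-(4 * ε)) := by
        rw [← rpow_add hyn, one_rpow, mul_one]; ring_nf
      _ ≤ ‖y‖ ^ (-(n - 2 * ε)) * (2 ^ (4 * ε) * ‖e - y‖ ^ (-(4 * ε))) := by
        gcongr
        exact h2 1 one_pos (by linarith)
      _ = _ := by ring
  · calc _ ≤ ‖y‖ ^ (-(n : ℝ)) * ‖y‖ ^ (-(2 * ε)) := by gcongr; exact hsq.2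
      _ = ‖y‖ ^ (-(n - 2 * ε)) * ‖y‖ ^ (-(4 * ε)) := by
        rw [← rpow_add hyn, ← rpow_add hyn]; ring_nf
      _ ≤ ‖y‖ ^ (-(n - 2 * ε)) * (2 ^ (4 * ε) * ‖e - y‖ ^ (-(4 * ε))) := by
        gcongr
        exact h2 _ hyn (by linarith)
      _ = _ := by ring

theorem lintegral_steinWeissTest_ne_zero {n : ℕ} [NeZero n] (β ε : ℝ) :
    ∫⁻ x : EuclideanSpace ℝ (Fin n),
      ENNReal.ofReal (‖x‖ ^ β * steinWeissTest β ε x ^ 2) ≠ 0 := by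
  rw [ne_eq, lintegral_eq_zero_iff (by fun_prop)]
  intro h
  obtain ⟨x, hx, hx0⟩ := (h.and (Measure.ae_ne volume (0 : EuclideanSpace ℝ (Fin n)))).exists
  have hxn : 0 < ‖x‖ := norm_pos_iff.2 hx0
  have hc := powCutoff_pos ε hxn
  simp only [Pi.zero_apply, ENNReal.ofReal_eq_zero, steinWeissTest] at hx
  exact hx.not_gt (by positivity)

/-- Bounded truncations with bounded support. -/
def truncation {n : ℕ} (v : EuclideanSpace ℝ (Fin n) → ℝ) (k : ℕ) :
    EuclideanSpace ℝ (Fin n) → ℝ :=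
  (Metric.closedBall 0 (k : ℝ)).indicator fun x => min (v x) k

theorem truncation_nonneg {n : ℕ} {v : EuclideanSpace ℝ (Fin n) → ℝ} (hv0 : ∀ x, 0 ≤ v x)
    (k : ℕ) (x : EuclideanSpace ℝ (Fin n)) : 0 ≤ truncation v k x :=
  indicator_nonneg (fun x _ => le_min (hv0 x) (Nat.cast_nonneg k)) x

theorem truncation_le {n : ℕ} {v : EuclideanSpace ℝ (Fin n) → ℝ} (hv0 : ∀ x, 0 ≤ v x)
    (k : ℕ) (x : EuclideanSpace ℝ (Fin n)) : truncation v k x ≤ v x :=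
  indicator_apply_le' (fun _ => min_le_left _ _) fun _ => hv0 x

theorem truncation_mono {n : ℕ} {v : EuclideanSpace ℝ (Fin n) → ℝ} (hv0 : ∀ x, 0 ≤ v x)
    (x : EuclideanSpace ℝ (Fin n)) : Monotone fun k => truncation v k x := by
  intro k l hkl
  have hkl' : (k : ℝ) ≤ l := by exact_mod_cast hkl
  refine (indicator_le_indicator_of_subset (Metric.closedBall_subset_closedBall hkl')
    (fun x => le_min (hv0 x) (Nat.cast_nonneg k)) x).trans ?_
  exact indicator_le_indicator (min_le_min_left _ hkl')

theorem truncation_eventually_eq {n : ℕ} (v : EuclideanSpace ℝ (Fin n) → ℝ)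
    (x : EuclideanSpace ℝ (Fin n)) : ∀ᶠ k in atTop, truncation v k x = v x := by
  filter_upwards [tendsto_natCast_atTop_atTop.eventually_ge_atTop ‖x‖,
    tendsto_natCast_atTop_atTop.eventually_ge_atTop (v x)] with k h1 h2
  rw [truncation, indicator_of_mem (by simpa using h1), min_eq_left h2]

theorem measurable_truncation {n : ℕ} {v : EuclideanSpace ℝ (Fin n) → ℝ} (hv : Measurable v)
    (k : ℕ) : Measurable (truncation v k) :=
  (hv.min measurable_const).indicator measurableSet_closedBall

theorem integrable_truncation {n : ℕ} {v : EuclideanSpace ℝ (Fin n) → ℝ} (hv : Measurable v)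
    (hv0 : ∀ x, 0 ≤ v x) (k : ℕ) : Integrable (truncation v k) := by
  refine IntegrableOn.integrable_indicator ?_ measurableSet_closedBall
  refine Measure.integrableOn_of_bounded (M := k) measure_closedBall_lt_top.ne
    (hv.min measurable_const).aestronglyMeasurable ?_
  refine Eventually.of_forall fun x => ?_
  rw [norm_of_nonneg (le_min (hv0 x) (Nat.cast_nonneg k))]
  exact min_le_right _ _

theorem tendsto_rieszEnergy_truncation {n : ℕ} (β : ℝ) {v : EuclideanSpace ℝ (Fin n) → ℝ}
    (hv : Measurable v) (hv0 : ∀ x, 0 ≤ v x) :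
    Tendsto (fun k => rieszEnergy β (truncation v k)) atTop (𝓝 (rieszEnergy β v)) := by
  have hprod : ∀ w : EuclideanSpace ℝ (Fin n) → ℝ, Measurable w → rieszEnergy β w =
      ∫⁻ q : EuclideanSpace ℝ (Fin n) × EuclideanSpace ℝ (Fin n),
        ENNReal.ofReal (w q.1 * w q.2 * ‖q.1 - q.2‖ ^ (β - n)) := fun w hw => by
    rw [Measure.volume_eq_prod, lintegral_prod _ (by fun_prop), rieszEnergy]
  have hmk := fun k => measurable_truncation hv k
  simp_rw [hprod _ hv, fun k => hprod _ (hmk k)]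
  refine lintegral_tendsto_of_tendsto_of_monotone (fun k => ?_) ?_ ?_
  · have := hmk k
    fun_prop
  · refine Eventually.of_forall fun q k l hkl => ENNReal.ofReal_le_ofReal ?_
    refine mul_le_mul_of_nonneg_right ?_ (by positivity)
    exact mul_le_mul (truncation_mono hv0 _ hkl) (truncation_mono hv0 _ hkl)
      (truncation_nonneg hv0 _ _) (truncation_nonneg hv0 _ _)
  · refine Eventually.of_forall fun q => tendsto_const_nhds.congr' ?_
    filter_upwards [truncation_eventually_eq v q.1, truncation_eventually_eq v q.2] with k h1 h2
    rw [h1, h2]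

/-- Sharpness of the Stein–Weiss constant, tested on integrable functions. -/
theorem mul_steinWeissConst_le {n : ℕ} [NeZero n] {β : ℝ} (hβ0 : 0 < β) (hβn : β < n)
    {c C : ℝ≥0∞} (hc : c ≠ ⊤)
    (h : ∀ v : EuclideanSpace ℝ (Fin n) → ℝ, Measurable v → (∀ x, 0 ≤ v x) → Integrable v →
      c * rieszEnergy β v ≤ C * ∫⁻ x, ENNReal.ofReal (‖x‖ ^ β * v x ^ 2)) :
    c * ENNReal.ofReal (steinWeissConst n β) ≤ C := by
  have hgen : ∀ v : EuclideanSpace ℝ (Fin n) → ℝ, Measurable v → (∀ x, 0 ≤ v x) →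
      c * rieszEnergy β v ≤ C * ∫⁻ x, ENNReal.ofReal (‖x‖ ^ β * v x ^ 2) := by
    intro v hv hv0
    refine le_of_tendsto' (ENNReal.Tendsto.const_mul (tendsto_rieszEnergy_truncation β hv hv0)
      (Or.inr hc)) fun k => ?_
    refine (h _ (measurable_truncation hv k) (truncation_nonneg hv0 k)
      (integrable_truncation hv hv0 k)).trans ?_
    gcongr with x
    · exact truncation_nonneg hv0 k x
    · exact truncation_le hv0 k x
  obtain ⟨e, he⟩ := exists_norm_eq (EuclideanSpace ℝ (Fin n)) (zero_le_one' ℝ)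
  set ε : ℕ → ℝ := fun k => 1 / (k + 1) / 5 with hε
  have hεpos : ∀ k, 0 < ε k := fun k => by positivity
  have hεlt : ∀ k, 4 * ε k < 1 := fun k => by
    have : 1 / ((k : ℝ) + 1) ≤ 1 := by
      rw [div_le_one (by positivity)]; linarith [(Nat.cast_nonneg k : (0 : ℝ) ≤ k)]
    simp only [hε]
    linarith
  have hε0 : Tendsto ε atTop (𝓝 0) := by
    simpa [hε] using (tendsto_one_div_add_atTop_nhds_zero_nat (𝕜 := ℝ)).div_const 5
  refine le_of_tendsto' (ENNReal.Tendsto.const_mul (tendsto_cutoffMass hβ0 hβn he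
    (fun k => (hεpos k).le) hε0) (Or.inr hc)) fun k => ?_
  have h1 := hgen _ (measurable_steinWeissTest β (ε k)) (steinWeissTest_nonneg β (ε k))
  have h2 : c * cutoffMass β (ε k) e * ∫⁻ x : EuclideanSpace ℝ (Fin n),
      ENNReal.ofReal (‖x‖ ^ β * steinWeissTest β (ε k) x ^ 2) ≤ C * ∫⁻ x :
      EuclideanSpace ℝ (Fin n), ENNReal.ofReal (‖x‖ ^ β * steinWeissTest β (ε k) x ^ 2) := by
    rw [mul_assoc]
    exact (mul_le_mul_right (mul_cutoffMass_le_rieszEnergy β (ε k) he) c).trans h1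
  exact (ENNReal.mul_le_mul_iff_left (lintegral_steinWeissTest_ne_zero β (ε k))
    (lintegral_steinWeissTest_ne_top (hεpos k) (hεlt k))).1 h2

/-- Tonelli's theorem for a product of functions of separate coordinates. -/
theorem lintegral_fin_prod_eq_prod {n : ℕ} {E : Fin n → Type*}
    {mE : ∀ i, MeasurableSpace (E i)} {μ : (i : Fin n) → Measure (E i)} [∀ i, SigmaFinite (μ i)]
    {f : (i : Fin n) → E i → ℝ≥0∞} (hf : ∀ i, Measurable (f i)) :
    ∫⁻ x : (i : Fin n) → E i, ∏ i, f i (x i) ∂(Measure.pi μ) = ∏ i, ∫⁻ x, f i x ∂(μ i) := by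
  induction n with
  | zero => simp
  | succ n ih =>
    have hm : Measurable fun x : (i : Fin n) → E i.succ => ∏ i, f i.succ (x i) := by
      have := fun i => hf i
      fun_prop
    rw [← ((measurePreserving_piFinSuccAbove μ 0).symm).lintegral_comp_emb
      (MeasurableEquiv.measurableEmbedding _), Fin.prod_univ_succ, ← ih fun i => hf i.succ]
    simp_rw [MeasurableEquiv.piFinSuccAbove_symm_apply, Fin.insertNthEquiv,
      Fin.prod_univ_succ, Fin.insertNth_zero]
    have : ∀ j : Fin n, SigmaFinite (μ (Fin.succAbove 0 j)) := fun j => inferInstance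
    exact lintegral_prod_mul (μ := μ 0) (ν := Measure.pi fun j : Fin n => μ j.succ)
      (hf 0).aemeasurable hm.aemeasurable

variable {m n : ℕ}

/-- The Gaussian weight on frequencies. -/
def gaussWeight (t : Fin m → ℝ) (ξ : Fin m → EuclideanSpace ℝ (Fin n)) : ℝ :=
  ∏ k, exp (-(π * ‖ξ k‖ ^ 2 * t k))

/-- The Fourier transform of `gaussWeight` restricted to the diagonal. -/
def gaussKernel (t : Fin m → ℝ) (z : EuclideanSpace ℝ (Fin n)) : ℝ :=
  ∏ k, (t k) ^ (-(n / 2 : ℝ)) * exp (-(π * ‖z‖ ^ 2 / t k))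

theorem integral_cexp_inner_mul_gaussian {t : ℝ} (ht : 0 < t) (z : EuclideanSpace ℝ (Fin n)) :
    ∫ η : EuclideanSpace ℝ (Fin n), Complex.exp (((-2 * π * ⟪z, η⟫_ℝ : ℝ) : ℂ) * Complex.I) *
      (exp (-(π * ‖η‖ ^ 2 * t)) : ℝ) =
    ((t ^ (-(n / 2 : ℝ)) * exp (-(π * ‖z‖ ^ 2 / t)) : ℝ) : ℂ) := by
  have h := GaussianFourier.integral_cexp_neg_mul_sq_norm_add (V := EuclideanSpace ℝ (Fin n))
    (b := ((π * t : ℝ) : ℂ)) (by rw [Complex.ofReal_re]; positivity) (-2 * π * Complex.I) z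
  have hl : ∀ η : EuclideanSpace ℝ (Fin n),
      Complex.exp (((-2 * π * ⟪z, η⟫_ℝ : ℝ) : ℂ) * Complex.I) * (exp (-(π * ‖η‖ ^ 2 * t)) : ℝ) =
      Complex.exp (-((π * t : ℝ) : ℂ) * ‖η‖ ^ 2 + -2 * π * Complex.I * ⟪z, η⟫_ℝ) := by
    intro η
    rw [Complex.ofReal_exp, ← Complex.exp_add]
    congr 1
    push_cast
    ring
  simp_rw [hl]
  rw [h, finrank_euclideanSpace_fin, Complex.ofReal_mul (t ^ (-(n / 2 : ℝ)))]
  congr 1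
  · rw [rpow_neg ht.le, ← inv_rpow ht.le, Complex.ofReal_cpow (by positivity)]
    push_cast
    congr 1
    have : (π : ℂ) ≠ 0 := by exact_mod_cast pi_ne_zero
    field_simp
  · rw [Complex.ofReal_exp]
    congr 1
    push_cast
    have h1 : (π : ℂ) ≠ 0 := by exact_mod_cast pi_ne_zero
    have h2 : (t : ℂ) ≠ 0 := by exact_mod_cast ht.ne'
    have := Complex.I_sq
    field_simp
    rw [this]
    ring

theorem integrable_gaussWeight {t : Fin m → ℝ} (ht : ∀ k, 0 < t k) :
    Integrable (gaussWeight (n := n) t) := by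
  unfold gaussWeight
  refine Integrable.fintype_prod (f := fun k (η : EuclideanSpace ℝ (Fin n)) =>
    exp (-(π * ‖η‖ ^ 2 * t k))) fun k => ?_
  refine ⟨by fun_prop, ?_⟩
  rw [hasFiniteIntegral_iff_ofReal (Eventually.of_forall fun _ => by positivity),
    lintegral_exp_neg_pi_mul_sq (ht k)]
  exact ENNReal.ofReal_lt_top

theorem gaussWeight_pos (t : Fin m → ℝ) (ξ : Fin m → EuclideanSpace ℝ (Fin n)) :
    0 < gaussWeight t ξ := Finset.prod_pos fun _ _ => exp_pos _

theorem gaussKernel_pos {t : Fin m → ℝ} (ht : ∀ k, 0 < t k) (z : EuclideanSpace ℝ (Fin n)) :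
    0 < gaussKernel t z :=
  Finset.prod_pos fun k _ => mul_pos (rpow_pos_of_pos (ht k) _) (exp_pos _)

@[fun_prop]
theorem continuous_gaussKernel (t : Fin m → ℝ) : Continuous (gaussKernel (n := n) t) := by
  unfold gaussKernel; fun_prop

theorem gaussKernel_le {t : Fin m → ℝ} (ht : ∀ k, 0 < t k) (z : EuclideanSpace ℝ (Fin n)) :
    gaussKernel t z ≤ ∏ k, (t k) ^ (-(n / 2 : ℝ)) := by
  refine Finset.prod_le_prod (fun k _ => ?_) fun k _ => ?_
  · have := ht k; positivity
  · have := ht k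
    refine mul_le_of_le_one_right (by positivity) (exp_le_one_iff.2 ?_)
    rw [neg_nonpos]; positivity

theorem integral_cexp_mul_gaussWeight {t : Fin m → ℝ} (ht : ∀ k, 0 < t k)
    (z : EuclideanSpace ℝ (Fin n)) :
    ∫ ξ : Fin m → EuclideanSpace ℝ (Fin n),
      Complex.exp (((-2 * π * ⟪z, ∑ k, ξ k⟫_ℝ : ℝ) : ℂ) * Complex.I) * (gaussWeight t ξ : ℂ) =
    (gaussKernel t z : ℂ) := by
  have h : ∀ ξ : Fin m → EuclideanSpace ℝ (Fin n),
      Complex.exp (((-2 * π * ⟪z, ∑ k, ξ k⟫_ℝ : ℝ) : ℂ) * Complex.I) * (gaussWeight t ξ : ℂ) =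
      ∏ k, (Complex.exp (((-2 * π * ⟪z, ξ k⟫_ℝ : ℝ) : ℂ) * Complex.I) *
        (exp (-(π * ‖ξ k‖ ^ 2 * t k)) : ℝ)) := by
    intro ξ
    rw [Finset.prod_mul_distrib, ← Complex.exp_sum, gaussWeight, inner_sum]
    push_cast
    rw [Finset.mul_sum, Finset.sum_mul]
  simp_rw [h]
  rw [volume_pi, integral_fintype_prod_eq_prod (fun k (η : EuclideanSpace ℝ (Fin n)) =>
    Complex.exp (((-2 * π * ⟪z, η⟫_ℝ : ℝ) : ℂ) * Complex.I) * (exp (-(π * ‖η‖ ^ 2 * t k)) : ℝ)),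
    gaussKernel, Complex.ofReal_prod]
  exact Finset.prod_congr rfl fun k _ => integral_cexp_inner_mul_gaussian (ht k) z

theorem continuous_fourier_of_integrable {φ : EuclideanSpace ℝ (Fin n) → ℂ}
    (hφ : Integrable φ) : Continuous (𝓕 φ) :=
  VectorFourier.fourierIntegral_continuous Real.continuous_fourierChar
    (by exact continuous_inner) hφ

theorem norm_fourier_le_integral_norm (φ : EuclideanSpace ℝ (Fin n) → ℂ)
    (η : EuclideanSpace ℝ (Fin n)) : ‖𝓕 φ η‖ ≤ ∫ x, ‖φ x‖ :=
  VectorFourier.norm_fourierIntegral_le_integral_norm _ _ _ _ _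

theorem integrable_gaussWeight_mul_normSq {t : Fin m → ℝ} (ht : ∀ k, 0 < t k)
    {φ : EuclideanSpace ℝ (Fin n) → ℂ} (hφ : Integrable φ) :
    Integrable fun ξ : Fin m → EuclideanSpace ℝ (Fin n) =>
      gaussWeight t ξ * ‖𝓕 φ (∑ k, ξ k)‖ ^ 2 := by
  have hc := continuous_fourier_of_integrable hφ
  refine (integrable_gaussWeight ht).mul_bdd (c := (∫ x, ‖φ x‖) ^ 2)
    (by fun_prop) (Eventually.of_forall fun ξ => ?_)
  rw [norm_pow, norm_norm]
  exact pow_le_pow_left₀ (norm_nonneg _) (norm_fourier_le_integral_norm φ _) 2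

theorem normSq_fourier_eq_integral {φ : EuclideanSpace ℝ (Fin n) → ℂ}
    (η : EuclideanSpace ℝ (Fin n)) :
    ((‖𝓕 φ η‖ ^ 2 : ℝ) : ℂ) =
      ∫ q : EuclideanSpace ℝ (Fin n) × EuclideanSpace ℝ (Fin n),
        Complex.exp (((-2 * π * ⟪q.1 - q.2, η⟫_ℝ : ℝ) : ℂ) * Complex.I) *
          (φ q.1 * conj (φ q.2)) := by
  rw [Complex.ofReal_pow, ← Complex.mul_conj', Real.fourier_eq', ← integral_conj,
    ← integral_prod_mul, ← Measure.volume_eq_prod]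
  refine integral_congr_ae (Eventually.of_forall fun q => ?_)
  simp only [smul_eq_mul, map_mul]
  rw [← Complex.exp_conj, map_mul, Complex.conj_ofReal, Complex.conj_I, inner_sub_left,
    show ((-2 * π * (⟪q.1, η⟫_ℝ - ⟪q.2, η⟫_ℝ) : ℝ) : ℂ) * Complex.I =
      ((-2 * π * ⟪q.1, η⟫_ℝ : ℝ) : ℂ) * Complex.I +
      ((-2 * π * ⟪q.2, η⟫_ℝ : ℝ) : ℂ) * -Complex.I by push_cast; ring, Complex.exp_add]
  ring

/-- Plancherel-type identity for Gaussian weights. -/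
theorem integral_gaussWeight_mul_normSq {t : Fin m → ℝ} (ht : ∀ k, 0 < t k)
    {φ : EuclideanSpace ℝ (Fin n) → ℂ} (hφ : Integrable φ) :
    ((∫ ξ : Fin m → EuclideanSpace ℝ (Fin n),
      gaussWeight t ξ * ‖𝓕 φ (∑ k, ξ k)‖ ^ 2 : ℝ) : ℂ) =
      ∫ q : EuclideanSpace ℝ (Fin n) × EuclideanSpace ℝ (Fin n),
        (gaussKernel t (q.1 - q.2) : ℂ) * (φ q.1 * conj (φ q.2)) := by
  have hint : Integrable (fun p : (Fin m → EuclideanSpace ℝ (Fin n)) ×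
      (EuclideanSpace ℝ (Fin n) × EuclideanSpace ℝ (Fin n)) =>
      Complex.exp (((-2 * π * ⟪p.2.1 - p.2.2, ∑ k, p.1 k⟫_ℝ : ℝ) : ℂ) * Complex.I) *
        ((gaussWeight t p.1 : ℂ) * (φ p.2.1 * conj (φ p.2.2)))) (volume.prod volume) := by
    have h1 : Integrable (fun p : (Fin m → EuclideanSpace ℝ (Fin n)) ×
      (EuclideanSpace ℝ (Fin n) × EuclideanSpace ℝ (Fin n)) =>
        (gaussWeight t p.1 : ℂ) * (φ p.2.1 * conj (φ p.2.2))) (volume.prod volume) := by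
      refine Integrable.mul_prod (f := fun ξ => (gaussWeight t ξ : ℂ))
        (g := fun q : EuclideanSpace ℝ (Fin n) × EuclideanSpace ℝ (Fin n) =>
          φ q.1 * conj (φ q.2)) ((integrable_gaussWeight ht).ofReal (𝕜 := ℂ)) ?_
      refine Integrable.mul_prod (f := φ) (g := fun y => conj (φ y)) hφ ?_
      exact (Complex.conjLIE.toContinuousLinearEquiv.integrable_comp_iff).2 hφ
    refine h1.bdd_mul (c := 1) (by fun_prop) (Eventually.of_forall fun p => ?_)
    rw [Complex.norm_exp_ofReal_mul_I]
  rw [← integral_complex_ofReal]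
  calc _ = ∫ ξ : Fin m → EuclideanSpace ℝ (Fin n),
        ∫ q : EuclideanSpace ℝ (Fin n) × EuclideanSpace ℝ (Fin n),
        Complex.exp (((-2 * π * ⟪q.1 - q.2, ∑ k, ξ k⟫_ℝ : ℝ) : ℂ) * Complex.I) *
          ((gaussWeight t ξ : ℂ) * (φ q.1 * conj (φ q.2))) := by
        refine integral_congr_ae (Eventually.of_forall fun ξ => ?_)
        simp only
        rw [Complex.ofReal_mul, normSq_fourier_eq_integral, ← integral_const_mul]
        refine integral_congr_ae (Eventually.of_forall fun q => ?_)
        simp only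
        ring
    _ = ∫ q : EuclideanSpace ℝ (Fin n) × EuclideanSpace ℝ (Fin n),
        ∫ ξ : Fin m → EuclideanSpace ℝ (Fin n),
        Complex.exp (((-2 * π * ⟪q.1 - q.2, ∑ k, ξ k⟫_ℝ : ℝ) : ℂ) * Complex.I) *
          ((gaussWeight t ξ : ℂ) * (φ q.1 * conj (φ q.2))) := integral_integral_swap hint
    _ = _ := by
        refine integral_congr_ae (Eventually.of_forall fun q => ?_)
        simp only
        rw [← integral_cexp_mul_gaussWeight ht, ← integral_mul_const]
        refine integral_congr_ae (Eventually.of_forall fun ξ => ?_)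
        simp only
        ring

theorem integrable_gaussKernel_mul {t : Fin m → ℝ} (ht : ∀ k, 0 < t k)
    {v : EuclideanSpace ℝ (Fin n) → ℝ} (hv : Integrable v) :
    Integrable fun q : EuclideanSpace ℝ (Fin n) × EuclideanSpace ℝ (Fin n) =>
        gaussKernel t (q.1 - q.2) * (v q.1 * v q.2) := by
  refine (hv.mul_prod hv).bdd_mul (c := ∏ k, (t k) ^ (-(n / 2 : ℝ)))
    (by fun_prop) (Eventually.of_forall fun q => ?_)
  rw [norm_of_nonneg (gaussKernel_pos ht _).le]
  exact gaussKernel_le ht _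

theorem lintegral_gaussWeight_mul_normSq_le {t : Fin m → ℝ} (ht : ∀ k, 0 < t k)
    {φ : EuclideanSpace ℝ (Fin n) → ℂ} (hφ : Integrable φ) :
    ∫⁻ ξ : Fin m → EuclideanSpace ℝ (Fin n),
      ENNReal.ofReal (gaussWeight t ξ * ‖𝓕 φ (∑ k, ξ k)‖ ^ 2) ≤
    ∫⁻ q : EuclideanSpace ℝ (Fin n) × EuclideanSpace ℝ (Fin n),
      ENNReal.ofReal (gaussKernel t (q.1 - q.2) * (‖φ q.1‖ * ‖φ q.2‖)) := by
  rw [← ofReal_integral_eq_lintegral_ofReal (integrable_gaussWeight_mul_normSq ht hφ)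
      (Eventually.of_forall fun ξ => mul_nonneg (gaussWeight_pos _ _).le (by positivity)),
    ← ofReal_integral_eq_lintegral_ofReal (integrable_gaussKernel_mul ht hφ.norm)
      (Eventually.of_forall fun q => mul_nonneg (gaussKernel_pos ht _).le (by positivity))]
  refine ENNReal.ofReal_le_ofReal ?_
  refine (le_abs_self _).trans ?_
  rw [← Real.norm_eq_abs, ← Complex.norm_real, integral_gaussWeight_mul_normSq ht hφ]
  refine (norm_integral_le_integral_norm _).trans_eq ?_
  refine integral_congr_ae (Eventually.of_forall fun q => ?_)
  simp only [norm_mul, Complex.norm_real, RCLike.norm_conj, Real.norm_eq_abs,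
    abs_of_pos (gaussKernel_pos ht _)]

theorem lintegral_gaussWeight_mul_normSq_eq {t : Fin m → ℝ} (ht : ∀ k, 0 < t k)
    {v : EuclideanSpace ℝ (Fin n) → ℝ} (hv : Integrable v) (hv0 : ∀ x, 0 ≤ v x) :
    ∫⁻ ξ : Fin m → EuclideanSpace ℝ (Fin n),
      ENNReal.ofReal (gaussWeight t ξ * ‖𝓕 (fun x => (v x : ℂ)) (∑ k, ξ k)‖ ^ 2) =
    ∫⁻ q : EuclideanSpace ℝ (Fin n) × EuclideanSpace ℝ (Fin n),
      ENNReal.ofReal (gaussKernel t (q.1 - q.2) * (v q.1 * v q.2)) := by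
  have hvC : Integrable fun x => (v x : ℂ) := hv.ofReal
  rw [← ofReal_integral_eq_lintegral_ofReal (integrable_gaussWeight_mul_normSq ht hvC)
      (Eventually.of_forall fun ξ => mul_nonneg (gaussWeight_pos _ _).le (by positivity)),
    ← ofReal_integral_eq_lintegral_ofReal (integrable_gaussKernel_mul ht hv)
      (Eventually.of_forall fun q => mul_nonneg (gaussKernel_pos ht _).le
        (mul_nonneg (hv0 _) (hv0 _)))]
  congr 1
  rw [← Complex.ofReal_inj]
  refine (integral_gaussWeight_mul_normSq ht hvC).trans ?_
  rw [← integral_complex_ofReal]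
  refine integral_congr_ae (Eventually.of_forall fun q => ?_)
  simp

/-- The constant in the Fourier transform of `‖x‖ ^ (-a)` on `ℝⁿ`. -/
def fourierRieszConst (n : ℕ) (a : ℝ) : ℝ :=
  π ^ (a - n / 2) * (Gamma ((n - a) / 2) / Gamma (a / 2))

theorem fourierRieszConst_pos {a : ℝ} (ha0 : 0 < a) (han : a < n) :
    0 < fourierRieszConst n a := by
  have h1 := Gamma_pos_of_pos (half_pos ha0)
  have h2 := Gamma_pos_of_pos (show 0 < ((n : ℝ) - a) / 2 by linarith)
  have := pi_pos
  unfold fourierRieszConst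
  positivity

theorem mul_fourierRieszConst {a : ℝ} (ha0 : 0 < a) :
    Gamma (a / 2) * π ^ (-(a / 2)) * fourierRieszConst n a =
      Gamma ((n - a) / 2) * π ^ (-((n - a) / 2)) := by
  have h1 := Gamma_pos_of_pos (half_pos ha0)
  have h : (π : ℝ) ^ (-((n - a) / 2)) = π ^ (-(a / 2)) * π ^ (a - n / 2) := by
    rw [← rpow_add pi_pos]; congr 1; ring
  rw [fourierRieszConst, h]
  field_simp

/-- The quadratic form with density `∏ ‖ξ k‖ ^ (-α k)` of the Fourier transform of `φ` at the
sum of the frequencies. -/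
def freqEnergy (α : Fin m → ℝ) (φ : EuclideanSpace ℝ (Fin n) → ℂ) : ℝ≥0∞ :=
  ∫⁻ ξ : Fin m → EuclideanSpace ℝ (Fin n),
    (∏ k, ENNReal.ofReal (‖ξ k‖ ^ (-α k))) * ENNReal.ofReal (‖𝓕 φ (∑ k, ξ k)‖ ^ 2)

/-- The density used for subordination to Gaussians. -/
def gammaDensity (α : Fin m → ℝ) (t : Fin m → ℝ) : ℝ≥0∞ :=
  ∏ k, ENNReal.ofReal (t k ^ (α k / 2 - 1))

@[fun_prop]
theorem measurable_gammaDensity (α : Fin m → ℝ) : Measurable (gammaDensity α) := by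
  unfold gammaDensity; fun_prop

theorem measurable_gaussWeight_uncurry :
    Measurable fun p : (Fin m → EuclideanSpace ℝ (Fin n)) × (Fin m → ℝ) =>
      gaussWeight p.2 p.1 := by
  unfold gaussWeight; fun_prop

theorem measurable_gaussKernel_uncurry :
    Measurable fun p : EuclideanSpace ℝ (Fin n) × (Fin m → ℝ) => gaussKernel p.2 p.1 := by
  unfold gaussKernel; fun_prop

theorem ae_pi_restrict_Ioi_pos :
    ∀ᵐ t ∂(Measure.pi fun _ : Fin m => (volume : Measure ℝ).restrict (Ioi 0)), ∀ k, 0 < t k := by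
  rw [ae_all_iff]
  intro k
  exact (Measure.quasiMeasurePreserving_eval
    (fun _ : Fin m => (volume : Measure ℝ).restrict (Ioi 0)) k).ae
    (ae_restrict_mem measurableSet_Ioi)

theorem lintegral_gammaDensity_mul_gaussWeight {α : Fin m → ℝ} (hα : ∀ k, 0 < α k)
    {ξ : Fin m → EuclideanSpace ℝ (Fin n)} (hξ : ∀ k, ξ k ≠ 0) :
    ∫⁻ t, gammaDensity α t * ENNReal.ofReal (gaussWeight t ξ)
      ∂(Measure.pi fun _ : Fin m => (volume : Measure ℝ).restrict (Ioi 0)) =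
    (∏ k, ENNReal.ofReal (Gamma (α k / 2) * π ^ (-(α k / 2)))) *
      ∏ k, ENNReal.ofReal (‖ξ k‖ ^ (-α k)) := by
  have h : ∀ t : Fin m → ℝ, gammaDensity α t * ENNReal.ofReal (gaussWeight t ξ) =
      ∏ k, ENNReal.ofReal (t k ^ (α k / 2 - 1)) *
        ENNReal.ofReal (exp (-(π * ‖ξ k‖ ^ 2 * t k))) := by
    intro t
    rw [gammaDensity, gaussWeight, ENNReal.ofReal_prod_of_nonneg (fun k _ => (exp_pos _).le),
      Finset.prod_mul_distrib]
  simp_rw [h]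
  rw [lintegral_fin_prod_eq_prod (f := fun k t => ENNReal.ofReal (t ^ (α k / 2 - 1)) *
    ENNReal.ofReal (exp (-(π * ‖ξ k‖ ^ 2 * t)))) (fun k => by fun_prop),
    ← Finset.prod_mul_distrib]
  refine Finset.prod_congr rfl fun k _ => ?_
  rw [← lintegral_rpow_mul_exp_neg_pi_mul_sq (hα k) (norm_pos_iff.2 (hξ k))]
  refine setLIntegral_congr_fun measurableSet_Ioi fun t ht => ?_
  rw [mem_Ioi] at ht
  rw [← ENNReal.ofReal_mul (by positivity)]

theorem lintegral_gammaDensity_mul_gaussKernel {α : Fin m → ℝ} (hα : ∀ k, α k < n)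
    {z : EuclideanSpace ℝ (Fin n)} (hz : z ≠ 0) :
    ∫⁻ t, gammaDensity α t * ENNReal.ofReal (gaussKernel t z)
      ∂(Measure.pi fun _ : Fin m => (volume : Measure ℝ).restrict (Ioi 0)) =
    (∏ k, ENNReal.ofReal (Gamma ((n - α k) / 2) * π ^ (-((n - α k) / 2)))) *
      ENNReal.ofReal (‖z‖ ^ (∑ k, (α k - n))) := by
  have h : ∀ᵐ t ∂(Measure.pi fun _ : Fin m => (volume : Measure ℝ).restrict (Ioi 0)),
      gammaDensity α t * ENNReal.ofReal (gaussKernel t z) =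
      ∏ k, ENNReal.ofReal (t k ^ (α k / 2 - 1)) *
        ENNReal.ofReal ((t k) ^ (-(n / 2 : ℝ)) * exp (-(π * ‖z‖ ^ 2 / t k))) := by
    filter_upwards [ae_pi_restrict_Ioi_pos] with t ht
    rw [gammaDensity, gaussKernel, ENNReal.ofReal_prod_of_nonneg, Finset.prod_mul_distrib]
    intro k _
    have := ht k
    positivity
  rw [lintegral_congr_ae h, lintegral_fin_prod_eq_prod (f := fun k t =>
    ENNReal.ofReal (t ^ (α k / 2 - 1)) *
        ENNReal.ofReal (t ^ (-(n / 2 : ℝ)) * exp (-(π * ‖z‖ ^ 2 / t)))) (fun k => by fun_prop),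
    rpow_sum_of_pos (norm_pos_iff.2 hz), ENNReal.ofReal_prod_of_nonneg (fun k _ => by positivity),
    ← Finset.prod_mul_distrib]
  refine Finset.prod_congr rfl fun k _ => ?_
  have := lintegral_rpow_mul_exp_neg_pi_mul_sq_div (a := n - α k) (by linarith [hα k])
    (norm_pos_iff.2 hz)
  rw [show α k - n = -(n - α k) by ring, ← this]
  refine setLIntegral_congr_fun measurableSet_Ioi fun t ht => ?_
  rw [mem_Ioi] at ht
  rw [← ENNReal.ofReal_mul (by positivity), ← mul_assoc, ← rpow_add ht]
  congr 3
  ring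

theorem ae_forall_ne_zero [NeZero n] :
    ∀ᵐ ξ : Fin m → EuclideanSpace ℝ (Fin n), ∀ k, ξ k ≠ 0 := by
  rw [ae_all_iff]
  exact fun k => Measure.ae_eval_ne _ k 0

theorem mul_freqEnergy [NeZero n] {α : Fin m → ℝ} (hα : ∀ k, 0 < α k)
    {φ : EuclideanSpace ℝ (Fin n) → ℂ} (hφ : Integrable φ) :
    (∏ k, ENNReal.ofReal (Gamma (α k / 2) * π ^ (-(α k / 2)))) * freqEnergy α φ =
      ∫⁻ t, gammaDensity α t * (∫⁻ ξ : Fin m → EuclideanSpace ℝ (Fin n),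
        ENNReal.ofReal (gaussWeight t ξ * ‖𝓕 φ (∑ k, ξ k)‖ ^ 2))
        ∂(Measure.pi fun _ : Fin m => (volume : Measure ℝ).restrict (Ioi 0)) := by
  have hc := (continuous_fourier_of_integrable hφ).measurable
  have hw := measurable_gaussWeight_uncurry (m := m) (n := n)
  rw [freqEnergy, ← lintegral_const_mul' _ _ (ENNReal.prod_ne_top fun _ _ => ENNReal.ofReal_ne_top)]
  calc _ = ∫⁻ ξ : Fin m → EuclideanSpace ℝ (Fin n), ∫⁻ t, gammaDensity α t *
        ENNReal.ofReal (gaussWeight t ξ * ‖𝓕 φ (∑ k, ξ k)‖ ^ 2)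
        ∂(Measure.pi fun _ : Fin m => (volume : Measure ℝ).restrict (Ioi 0)) := by
        refine lintegral_congr_ae ?_
        filter_upwards [ae_forall_ne_zero (m := m) (n := n)] with ξ hξ
        rw [← mul_assoc, ← lintegral_gammaDensity_mul_gaussWeight hα hξ,
          ← lintegral_mul_const' _ _ ENNReal.ofReal_ne_top]
        refine lintegral_congr fun t => ?_
        rw [mul_assoc, ENNReal.ofReal_mul (gaussWeight_pos _ _).le]
    _ = _ := by
        rw [lintegral_lintegral_swap]
        · refine lintegral_congr fun t => ?_
          rw [lintegral_const_mul']
          exact ENNReal.prod_ne_top fun _ _ => ENNReal.ofReal_ne_top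
        · refine Measurable.aemeasurable ?_
          unfold Function.uncurry
          fun_prop

theorem lintegral_gammaDensity_mul_lintegral [NeZero n] {α : Fin m → ℝ} (hα : ∀ k, α k < n)
    {β : ℝ} (hβ : β - n = ∑ k, (α k - n))
    {v : EuclideanSpace ℝ (Fin n) → ℝ} (hv : Measurable v) (hv0 : ∀ x, 0 ≤ v x) :
    ∫⁻ t, gammaDensity α t * (∫⁻ q : EuclideanSpace ℝ (Fin n) × EuclideanSpace ℝ (Fin n),
        ENNReal.ofReal (gaussKernel t (q.1 - q.2) * (v q.1 * v q.2)))
        ∂(Measure.pi fun _ : Fin m => (volume : Measure ℝ).restrict (Ioi 0)) =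
    (∏ k, ENNReal.ofReal (Gamma ((n - α k) / 2) * π ^ (-((n - α k) / 2)))) *
      rieszEnergy β v := by
  have hk := measurable_gaussKernel_uncurry (m := m) (n := n)
  have hk' : Measurable fun p : (Fin m → ℝ) × (EuclideanSpace ℝ (Fin n) ×
      EuclideanSpace ℝ (Fin n)) => gaussKernel p.1 (p.2.1 - p.2.2) :=
    hk.comp (((measurable_fst.comp measurable_snd).sub
      (measurable_snd.comp measurable_snd)).prodMk measurable_fst)
  have hk'' : ∀ z : EuclideanSpace ℝ (Fin n), Measurable fun t : Fin m → ℝ => gaussKernel t z :=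
    fun z => hk.comp (measurable_const.prodMk measurable_id)
  have hH : (∏ k, ENNReal.ofReal (Gamma ((n - α k) / 2) * π ^ (-((n - α k) / 2)))) ≠ ⊤ :=
    ENNReal.prod_ne_top fun _ _ => ENNReal.ofReal_ne_top
  calc _ = ∫⁻ t, (∫⁻ q : EuclideanSpace ℝ (Fin n) × EuclideanSpace ℝ (Fin n), gammaDensity α t *
        ENNReal.ofReal (gaussKernel t (q.1 - q.2) * (v q.1 * v q.2)))
        ∂(Measure.pi fun _ : Fin m => (volume : Measure ℝ).restrict (Ioi 0)) := by
        refine lintegral_congr fun t => ?_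
        rw [lintegral_const_mul']
        exact ENNReal.prod_ne_top fun _ _ => ENNReal.ofReal_ne_top
    _ = ∫⁻ q : EuclideanSpace ℝ (Fin n) × EuclideanSpace ℝ (Fin n), ENNReal.ofReal (v q.1 * v q.2) *
        ∫⁻ t, gammaDensity α t * ENNReal.ofReal (gaussKernel t (q.1 - q.2))
        ∂(Measure.pi fun _ : Fin m => (volume : Measure ℝ).restrict (Ioi 0)) := by
        rw [lintegral_lintegral_swap]
        · refine lintegral_congr fun q => ?_
          rw [← lintegral_const_mul' _ _ ENNReal.ofReal_ne_top]
          refine lintegral_congr fun t => ?_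
          rw [ENNReal.ofReal_mul' (mul_nonneg (hv0 _) (hv0 _))]
          ring
        · refine Measurable.aemeasurable ?_
          unfold Function.uncurry
          fun_prop
    _ = _ := by
        rw [Measure.volume_eq_prod, lintegral_prod, rieszEnergy, ← lintegral_const_mul' _ _ hH]
        · refine lintegral_congr fun x => ?_
          rw [← lintegral_const_mul' _ _ hH]
          refine lintegral_congr_ae ?_
          filter_upwards [Measure.ae_ne volume x] with y hy
          rw [lintegral_gammaDensity_mul_gaussKernel hα (sub_ne_zero.2 hy.symm), hβ,
            ENNReal.ofReal_mul (mul_nonneg (hv0 _) (hv0 _))]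
          ring
        · refine Measurable.aemeasurable ?_
          have : Measurable fun q : EuclideanSpace ℝ (Fin n) × EuclideanSpace ℝ (Fin n) =>
            ∫⁻ t, gammaDensity α t * ENNReal.ofReal (gaussKernel t (q.1 - q.2))
              ∂(Measure.pi fun _ : Fin m => (volume : Measure ℝ).restrict (Ioi 0)) := by
            refine Measurable.lintegral_prod_left ?_
            fun_prop
          fun_prop

theorem prod_ofReal_mul_fourierRieszConst {α : Fin m → ℝ} (hα : ∀ k, 0 < α k) :
    (∏ k, ENNReal.ofReal (Gamma (α k / 2) * π ^ (-(α k / 2)))) *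
      (∏ k, ENNReal.ofReal (fourierRieszConst n (α k))) =
    ∏ k, ENNReal.ofReal (Gamma ((n - α k) / 2) * π ^ (-((n - α k) / 2))) := by
  rw [← Finset.prod_mul_distrib]
  refine Finset.prod_congr rfl fun k _ => ?_
  have := Gamma_pos_of_pos (half_pos (hα k))
  rw [← ENNReal.ofReal_mul (by positivity), mul_fourierRieszConst (hα k)]

theorem prod_ofReal_Gamma_ne_zero {α : Fin m → ℝ} (hα : ∀ k, 0 < α k) :
    (∏ k, ENNReal.ofReal (Gamma (α k / 2) * π ^ (-(α k / 2)))) ≠ 0 := by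
  rw [Finset.prod_ne_zero_iff]
  intro k _
  have := Gamma_pos_of_pos (half_pos (hα k))
  have := pi_pos
  rw [ne_eq, ENNReal.ofReal_eq_zero, not_le]
  positivity

theorem freqEnergy_le [NeZero n] {α : Fin m → ℝ} (hα0 : ∀ k, 0 < α k) (hα : ∀ k, α k < n)
    {β : ℝ} (hβ : β - n = ∑ k, (α k - n))
    {φ : EuclideanSpace ℝ (Fin n) → ℂ} (hφm : Measurable φ) (hφ : Integrable φ) :
    freqEnergy α φ ≤ (∏ k, ENNReal.ofReal (fourierRieszConst n (α k))) *
      rieszEnergy β fun x => ‖φ x‖ := by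
  rw [← ENNReal.mul_le_mul_iff_right (prod_ofReal_Gamma_ne_zero hα0)
    (ENNReal.prod_ne_top fun _ _ => ENNReal.ofReal_ne_top), mul_freqEnergy hα0 hφ, ← mul_assoc,
    prod_ofReal_mul_fourierRieszConst hα0,
    ← lintegral_gammaDensity_mul_lintegral hα hβ hφm.norm fun _ => norm_nonneg _]
  refine lintegral_mono_ae ?_
  filter_upwards [ae_pi_restrict_Ioi_pos] with t ht
  exact mul_le_mul_right (lintegral_gaussWeight_mul_normSq_le ht hφ) _

theorem freqEnergy_ofReal [NeZero n] {α : Fin m → ℝ} (hα0 : ∀ k, 0 < α k) (hα : ∀ k, α k < n)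
    {β : ℝ} (hβ : β - n = ∑ k, (α k - n))
    {v : EuclideanSpace ℝ (Fin n) → ℝ} (hvm : Measurable v) (hv0 : ∀ x, 0 ≤ v x)
    (hv : Integrable v) :
    freqEnergy α (fun x => (v x : ℂ)) =
      (∏ k, ENNReal.ofReal (fourierRieszConst n (α k))) * rieszEnergy β v := by
  have hvC : Integrable fun x => (v x : ℂ) := hv.ofReal
  rw [← ENNReal.mul_right_inj (prod_ofReal_Gamma_ne_zero hα0)
    (ENNReal.prod_ne_top fun _ _ => ENNReal.ofReal_ne_top), mul_freqEnergy hα0 hvC, ← mul_assoc,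
    prod_ofReal_mul_fourierRieszConst hα0, ← lintegral_gammaDensity_mul_lintegral hα hβ hvm hv0]
  refine lintegral_congr_ae ?_
  filter_upwards [ae_pi_restrict_Ioi_pos] with t ht
  rw [lintegral_gaussWeight_mul_normSq_eq ht hv hv0]

/-- The identification of the `L²` product of Euclidean spaces with the plain product. -/
def piEquiv (m n : ℕ) : PiLp 2 (fun _ : Fin m => EuclideanSpace ℝ (Fin n)) ≃L[ℝ]
    (Fin m → EuclideanSpace ℝ (Fin n)) :=
  PiLp.continuousLinearEquiv 2 ℝ fun _ => EuclideanSpace ℝ (Fin n)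

@[simp]
theorem piEquiv_apply (x : PiLp 2 (fun _ : Fin m => EuclideanSpace ℝ (Fin n))) (k : Fin m) :
    piEquiv m n x k = x k := rfl

theorem measurePreserving_piEquiv : MeasurePreserving (piEquiv m n) := by
  refine ⟨(piEquiv m n).continuous.measurable, ?_⟩
  have := (piEquiv m n).isAddHaarMeasure_map volume
  have hsmul := Measure.isAddLeftInvariant_eq_smul (Measure.map (piEquiv m n) volume)
    (volume : Measure (Fin m → EuclideanSpace ℝ (Fin n)))
  set c := (Measure.map (piEquiv m n) volume).addHaarScalarFactor
    (volume : Measure (Fin m → EuclideanSpace ℝ (Fin n)))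
  have h1 : ∫ y : Fin m → EuclideanSpace ℝ (Fin n), ∏ k, exp (-π * ‖y k‖ ^ 2)
      ∂(Measure.map (piEquiv m n) volume) = 1 := by
    rw [integral_map (piEquiv m n).continuous.measurable.aemeasurable
      (Continuous.aestronglyMeasurable (by fun_prop))]
    have := GaussianFourier.integral_rexp_neg_mul_sq_norm
      (V := PiLp 2 (fun _ : Fin m => EuclideanSpace ℝ (Fin n))) pi_pos
    rw [div_self pi_ne_zero, one_rpow] at this
    rw [← this]
    refine integral_congr_ae (Eventually.of_forall fun x => ?_)
    simp only [piEquiv_apply]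
    rw [← exp_sum, PiLp.norm_sq_eq_of_L2, Finset.mul_sum]
  have h2 : ∫ y : Fin m → EuclideanSpace ℝ (Fin n), ∏ k, exp (-π * ‖y k‖ ^ 2) = 1 := by
    rw [volume_pi, integral_fintype_prod_eq_prod (fun _ (y : EuclideanSpace ℝ (Fin n)) =>
      exp (-π * ‖y‖ ^ 2))]
    refine Finset.prod_eq_one fun k _ => ?_
    rw [GaussianFourier.integral_rexp_neg_mul_sq_norm pi_pos, div_self pi_ne_zero, one_rpow]
  rw [hsmul, integral_smul_nnreal_measure, h2] at h1
  have hc : c = 1 := by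
    rw [NNReal.smul_def, smul_eq_mul, mul_one] at h1
    exact_mod_cast h1
  rw [hsmul, hc, one_smul]

theorem integral_comp_piEquiv (g : (Fin m → EuclideanSpace ℝ (Fin n)) → ℂ) :
    ∫ x, g (piEquiv m n x) = ∫ y, g y :=
  measurePreserving_piEquiv.integral_comp
    (piEquiv m n).toHomeomorph.measurableEmbedding g

theorem fourierM_eq_fourierInv (f : (Fin m → EuclideanSpace ℝ (Fin n)) → ℂ)
    (w : PiLp 2 (fun _ : Fin m => EuclideanSpace ℝ (Fin n))) :
    fourierM f (piEquiv m n w) = 𝓕⁻ (f ∘ piEquiv m n) w := by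
  rw [fourierM, Real.fourierInv_eq', ← integral_comp_piEquiv]
  refine integral_congr_ae (Eventually.of_forall fun x => ?_)
  simp only [smul_eq_mul, Function.comp_apply, PiLp.inner_apply, piEquiv_apply]
  congr 2
  push_cast
  ring

theorem fourier_comp_piEquiv (F : (Fin m → EuclideanSpace ℝ (Fin n)) → ℂ)
    (w : PiLp 2 (fun _ : Fin m => EuclideanSpace ℝ (Fin n))) :
    𝓕 (F ∘ piEquiv m n) w =
      ∫ ξ, Complex.exp (((-2 * π * ∑ k, ⟪piEquiv m n w k, ξ k⟫_ℝ : ℝ) : ℂ) * Complex.I) * F ξ := by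
  rw [Real.fourier_eq', ← integral_comp_piEquiv]
  refine integral_congr_ae (Eventually.of_forall fun x => ?_)
  simp only [smul_eq_mul, Function.comp_apply, PiLp.inner_apply, piEquiv_apply,
    real_inner_comm]

/-- `F` is the transform of `f` and Fourier inversion holds. -/
def IsFourierPair (f F : (Fin m → EuclideanSpace ℝ (Fin n)) → ℂ) : Prop :=
  (∀ ξ, fourierM f ξ = F ξ) ∧
    ∀ x, f x = ∫ ξ, Complex.exp (((-2 * π * ∑ k, ⟪x k, ξ k⟫_ℝ : ℝ) : ℂ) * Complex.I) * F ξ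

theorem exists_schwartz_transform (f : SchwartzMap (Fin m → EuclideanSpace ℝ (Fin n)) ℂ) :
    ∃ F : SchwartzMap (Fin m → EuclideanSpace ℝ (Fin n)) ℂ, IsFourierPair f F := by
  set g := SchwartzMap.compCLMOfContinuousLinearEquiv ℂ (piEquiv m n) f with hg
  have hgf : ⇑g = f ∘ piEquiv m n := rfl
  set F := SchwartzMap.compCLMOfContinuousLinearEquiv ℂ (piEquiv m n).symm (𝓕⁻ g) with hF
  have hFg : F ∘ piEquiv m n = 𝓕⁻ g := by
    ext w; simp [hF]
  refine ⟨F, fun ξ => ?_, fun x => ?_⟩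
  · obtain ⟨w, rfl⟩ := (piEquiv m n).surjective ξ
    rw [fourierM_eq_fourierInv, ← hgf, ← SchwartzMap.fourierInv_coe, ← hFg, Function.comp_apply]
  · obtain ⟨w, rfl⟩ := (piEquiv m n).surjective x
    rw [← fourier_comp_piEquiv, hFg, ← SchwartzMap.fourier_coe, FourierTransform.fourier_fourierInv_eq]
    rfl

theorem exists_schwartz_preimage (F : SchwartzMap (Fin m → EuclideanSpace ℝ (Fin n)) ℂ) :
    ∃ f : SchwartzMap (Fin m → EuclideanSpace ℝ (Fin n)) ℂ, IsFourierPair f F := by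
  set G := SchwartzMap.compCLMOfContinuousLinearEquiv ℂ (piEquiv m n) F with hG
  have hGF : ⇑G = F ∘ piEquiv m n := rfl
  set f := SchwartzMap.compCLMOfContinuousLinearEquiv ℂ (piEquiv m n).symm (𝓕 G) with hf
  have hfG : f ∘ piEquiv m n = 𝓕 G := by
    ext w; simp [hf]
  refine ⟨f, fun ξ => ?_, fun x => ?_⟩
  · obtain ⟨w, rfl⟩ := (piEquiv m n).surjective ξ
    rw [fourierM_eq_fourierInv, hfG, ← SchwartzMap.fourierInv_coe,
      FourierTransform.fourierInv_fourier_eq]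
    rfl
  · obtain ⟨w, rfl⟩ := (piEquiv m n).surjective x
    rw [← fourier_comp_piEquiv, ← hGF, ← SchwartzMap.fourier_coe, ← hfG, Function.comp_apply]

instance hasTemperateGrowth_volume_pi :
    (volume : Measure (Fin m → EuclideanSpace ℝ (Fin n))).HasTemperateGrowth :=
  Measure.IsAddHaarMeasure.instHasTemperateGrowth
    (h := inferInstanceAs (volume : Measure (Fin m → EuclideanSpace ℝ (Fin n))).IsAddHaarMeasure)

/-- Pairing of the diagonal trace with an integrable function on the frequency side. -/
theorem integral_diag_mul {f F : SchwartzMap (Fin m → EuclideanSpace ℝ (Fin n)) ℂ}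
    (h : IsFourierPair f F) {φ : EuclideanSpace ℝ (Fin n) → ℂ} (hφ : Integrable φ) :
    ∫ x, f (fun _ => x) * φ x = ∫ ξ, F ξ * 𝓕 φ (∑ k, ξ k) := by
  have hint : Integrable (fun p : EuclideanSpace ℝ (Fin n) × (Fin m → EuclideanSpace ℝ (Fin n)) =>
      Complex.exp (((-2 * π * ⟪p.1, ∑ k, p.2 k⟫_ℝ : ℝ) : ℂ) * Complex.I) *
        (φ p.1 * F p.2)) (volume.prod volume) := by
    refine (Integrable.mul_prod (f := φ) (g := fun ξ => F ξ) hφ F.integrable).bdd_mul (c := 1)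
      (by fun_prop) (Eventually.of_forall fun p => ?_)
    rw [Complex.norm_exp_ofReal_mul_I]
  calc _ = ∫ x : EuclideanSpace ℝ (Fin n), ∫ ξ : Fin m → EuclideanSpace ℝ (Fin n),
        Complex.exp (((-2 * π * ⟪x, ∑ k, ξ k⟫_ℝ : ℝ) : ℂ) * Complex.I) * (φ x * F ξ) := by
        refine integral_congr_ae (Eventually.of_forall fun x => ?_)
        simp only
        rw [h.2, ← integral_mul_const]
        refine integral_congr_ae (Eventually.of_forall fun ξ => ?_)
        simp only [inner_sum]
        ring
    _ = ∫ ξ : Fin m → EuclideanSpace ℝ (Fin n), ∫ x : EuclideanSpace ℝ (Fin n),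
        Complex.exp (((-2 * π * ⟪x, ∑ k, ξ k⟫_ℝ : ℝ) : ℂ) * Complex.I) * (φ x * F ξ) :=
        integral_integral_swap hint
    _ = _ := by
        refine integral_congr_ae (Eventually.of_forall fun ξ => ?_)
        simp only
        rw [Real.fourier_eq', ← integral_const_mul]
        refine integral_congr_ae (Eventually.of_forall fun x => ?_)
        simp only [smul_eq_mul]
        ring

theorem lintegral_mul_sq_le {X : Type*} [MeasurableSpace X] {μ : Measure X} {f g : X → ℝ≥0∞}
    (hf : AEMeasurable f μ) (hg : AEMeasurable g μ) :
    (∫⁻ x, f x * g x ∂μ) ^ 2 ≤ (∫⁻ x, f x ^ 2 ∂μ) * ∫⁻ x, g x ^ 2 ∂μ := by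
  have h := ENNReal.lintegral_mul_le_Lp_mul_Lq μ Real.HolderConjugate.two_two hf hg
  simp only [Pi.mul_apply, ENNReal.rpow_two] at h
  refine (pow_le_pow_left' h 2).trans_eq ?_
  rw [mul_pow, ← ENNReal.rpow_two, ← ENNReal.rpow_two, ← ENNReal.rpow_mul, ← ENNReal.rpow_mul]
  norm_num

theorem ofReal_rpow_half_sq (r a : ℝ) (hr : 0 ≤ r) :
    ENNReal.ofReal (r ^ (a / 2)) ^ 2 = ENNReal.ofReal (r ^ a) := by
  rw [← ENNReal.ofReal_pow (by positivity), ← rpow_mul_natCast hr]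
  norm_num

/-- The weighted Cauchy–Schwarz inequality on the frequency side. -/
theorem lintegral_enorm_mul_sq_le [NeZero n] (α : Fin m → ℝ)
    {G : (Fin m → EuclideanSpace ℝ (Fin n)) → ℂ} (hG : Measurable G)
    {φ : EuclideanSpace ℝ (Fin n) → ℂ} (hφ : Integrable φ) :
    (∫⁻ ξ, ‖G ξ * 𝓕 φ (∑ k, ξ k)‖ₑ) ^ 2 ≤
      (∫⁻ ξ, (∏ k, ENNReal.ofReal (‖ξ k‖ ^ α k)) * ‖G ξ‖ₑ ^ 2) * freqEnergy α φ := by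
  have hc := (continuous_fourier_of_integrable hφ).measurable
  have hle : ∫⁻ ξ, ‖G ξ * 𝓕 φ (∑ k, ξ k)‖ₑ =
      ∫⁻ ξ : Fin m → EuclideanSpace ℝ (Fin n),
        ((∏ k, ENNReal.ofReal (‖ξ k‖ ^ (α k / 2))) * ‖G ξ‖ₑ) *
        ((∏ k, ENNReal.ofReal (‖ξ k‖ ^ (-α k / 2))) * ‖𝓕 φ (∑ k, ξ k)‖ₑ) := by
    refine lintegral_congr_ae ?_
    filter_upwards [ae_forall_ne_zero (m := m) (n := n)] with ξ hξ
    rw [mul_mul_mul_comm, ← Finset.prod_mul_distrib, Finset.prod_eq_one, one_mul, enorm_mul]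
    intro k _
    have := norm_pos_iff.2 (hξ k)
    rw [← ENNReal.ofReal_mul (by positivity), ← rpow_add this, neg_div, add_neg_cancel, rpow_zero,
      ENNReal.ofReal_one]
  rw [hle]
  refine (lintegral_mul_sq_le (by fun_prop) (by fun_prop)).trans_eq ?_
  congr 1
  · refine lintegral_congr fun ξ => ?_
    rw [mul_pow, ← Finset.prod_pow]
    simp only [ofReal_rpow_half_sq _ _ (norm_nonneg _)]
  · refine lintegral_congr fun ξ => ?_
    rw [mul_pow, ← Finset.prod_pow, ENNReal.ofReal_pow (norm_nonneg _), ofReal_norm]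
    simp only [ofReal_rpow_half_sq _ _ (norm_nonneg _)]

theorem LamM_eq_lintegral {f F : SchwartzMap (Fin m → EuclideanSpace ℝ (Fin n)) ℂ}
    (h : IsFourierPair f F) (α : Fin m → ℝ) :
    LamM (fun x => f x) α = ∫⁻ ξ, (∏ k, ENNReal.ofReal (‖ξ k‖ ^ α k)) * ‖F ξ‖ₑ ^ 2 := by
  refine lintegral_congr fun ξ => ?_
  rw [h.1]; rfl

/-- The pairing of the trace of `f` with `φ` is controlled by the two dual energies. -/
theorem enorm_integral_diag_mul_sq_le [NeZero n]
    {f F : SchwartzMap (Fin m → EuclideanSpace ℝ (Fin n)) ℂ}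
    (h : IsFourierPair f F) (α : Fin m → ℝ) {φ : EuclideanSpace ℝ (Fin n) → ℂ}
    (hφ : Integrable φ) :
    ‖∫ x, f (fun _ => x) * φ x‖ₑ ^ 2 ≤ LamM (fun x => f x) α * freqEnergy α φ := by
  rw [integral_diag_mul h hφ, LamM_eq_lintegral h]
  exact (pow_le_pow_left' (enorm_integral_le_lintegral_enorm _) 2).trans
    (lintegral_enorm_mul_sq_le α F.continuous.measurable hφ)

/-- The diagonal trace of a Schwartz function, as a Schwartz function. -/
def diagTrace [NeZero m] (f : SchwartzMap (Fin m → EuclideanSpace ℝ (Fin n)) ℂ) :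
    SchwartzMap (EuclideanSpace ℝ (Fin n)) ℂ :=
  SchwartzMap.compCLMOfAntilipschitz (K := 1) ℂ
    (ContinuousLinearMap.pi fun _ : Fin m =>
      ContinuousLinearMap.id ℝ (EuclideanSpace ℝ (Fin n))).hasTemperateGrowth
    (AddMonoidHomClass.antilipschitz_of_bound _ fun x => by
      rw [NNReal.coe_one, one_mul]
      exact (pi_norm_const (ι := Fin m) x).ge) f

@[simp]
theorem diagTrace_apply [NeZero m] (f : SchwartzMap (Fin m → EuclideanSpace ℝ (Fin n)) ℂ)
    (x : EuclideanSpace ℝ (Fin n)) : diagTrace f x = f fun _ => x := rfl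

theorem integrableOn_norm_rpow_neg [NeZero n] {β : ℝ} (hβ0 : 0 < β) (hβn : β < n) :
    IntegrableOn (fun x : EuclideanSpace ℝ (Fin n) => ‖x‖ ^ (-β)) (Metric.closedBall 0 1) := by
  obtain ⟨x₀, hx₀⟩ : ∃ x₀ : EuclideanSpace ℝ (Fin n), ‖x₀‖ = 1 := exists_norm_eq _ zero_le_one
  have hx₀' : x₀ ≠ 0 := by rintro rfl; simp at hx₀
  refine ⟨Measurable.aestronglyMeasurable (by fun_prop), ?_⟩
  rw [hasFiniteIntegral_iff_ofReal (Eventually.of_forall fun _ => by positivity)]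
  have h := lintegral_riesz_mul_riesz (n := n) (a := β) (b := n - β / 2) hβ0 hβn (by linarith)
    (by linarith) (by linarith) hx₀'
  have hlt : ENNReal.ofReal (2 ^ (n - β / 2)) * ∫⁻ y : EuclideanSpace ℝ (Fin n),
      ENNReal.ofReal (‖y‖ ^ (-β)) * ENNReal.ofReal (‖x₀ - y‖ ^ (-(n - β / 2))) < ⊤ := by
    rw [h]; exact ENNReal.mul_lt_top ENNReal.ofReal_lt_top ENNReal.ofReal_lt_top
  refine lt_of_le_of_lt ?_ hlt
  rw [← lintegral_const_mul' _ _ ENNReal.ofReal_ne_top]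
  refine le_trans ?_ (setLIntegral_le_lintegral (Metric.closedBall 0 1) _)
  refine lintegral_mono_ae ?_
  filter_upwards [ae_restrict_mem Metric.isClosed_closedBall.measurableSet,
    ae_restrict_of_ae (Measure.ae_ne volume x₀)] with y hy hne
  rw [← ENNReal.ofReal_mul (by positivity), ← ENNReal.ofReal_mul (by positivity)]
  refine ENNReal.ofReal_le_ofReal ?_
  rw [mem_closedBall_zero_iff] at hy
  have h2 : ‖x₀ - y‖ ≤ 2 := (norm_sub_le _ _).trans (by linarith)
  have h3 : 0 < ‖x₀ - y‖ := norm_pos_iff.2 (sub_ne_zero.2 hne.symm)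
  have h4 : 1 ≤ 2 ^ (n - β / 2) * ‖x₀ - y‖ ^ (-(n - β / 2)) := by
    rw [rpow_neg h3.le, ← div_eq_mul_inv, one_le_div (by positivity)]
    exact rpow_le_rpow h3.le h2 (by linarith)
  calc ‖y‖ ^ (-β) = ‖y‖ ^ (-β) * 1 := (mul_one _).symm
    _ ≤ ‖y‖ ^ (-β) * (2 ^ (n - β / 2) * ‖x₀ - y‖ ^ (-(n - β / 2))) := by gcongr
    _ = _ := by ring

theorem integrable_norm_rpow_neg_mul [NeZero n] {β : ℝ} (hβ0 : 0 < β) (hβn : β < n)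
    {h : EuclideanSpace ℝ (Fin n) → ℝ} (hh : Integrable h) {M : ℝ} (hM : ∀ x, ‖h x‖ ≤ M) :
    Integrable fun x => ‖x‖ ^ (-β) * h x := by
  have hM0 : 0 ≤ M := (norm_nonneg _).trans (hM 0)
  have hb := (integrableOn_norm_rpow_neg hβ0 hβn).integrable_indicator
    Metric.isClosed_closedBall.measurableSet
  refine ((hb.mul_const M).add hh.norm).mono'
    (Measurable.aestronglyMeasurable (by fun_prop) |>.mul hh.aestronglyMeasurable)
    (Eventually.of_forall fun x => ?_)
  rw [norm_mul, norm_of_nonneg (by positivity), Pi.add_apply]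
  by_cases hx : x ∈ Metric.closedBall (0 : EuclideanSpace ℝ (Fin n)) 1
  · rw [indicator_of_mem hx]
    have := hM x
    have := norm_nonneg (h x)
    have : ‖x‖ ^ (-β) * ‖h x‖ ≤ ‖x‖ ^ (-β) * M := by gcongr
    linarith
  · rw [indicator_of_notMem hx, zero_mul, zero_add]
    rw [mem_closedBall_zero_iff, not_le] at hx
    exact mul_le_of_le_one_left (norm_nonneg _) (rpow_le_one_of_one_le_of_nonpos hx.le (by linarith))

theorem SchwartzMap.integrable_norm_sq (g : SchwartzMap (EuclideanSpace ℝ (Fin n)) ℂ) :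
    Integrable fun x => ‖g x‖ ^ 2 :=
  (memLp_two_iff_integrable_sq_norm g.continuous.aestronglyMeasurable).1 (g.memLp 2)

theorem integrable_weight_mul_norm_sq [NeZero n] {β : ℝ} (hβ0 : 0 < β) (hβn : β < n)
    (g : SchwartzMap (EuclideanSpace ℝ (Fin n)) ℂ) :
    Integrable fun x => ‖x‖ ^ (-β) * ‖g x‖ ^ 2 := by
  refine integrable_norm_rpow_neg_mul hβ0 hβn g.integrable_norm_sq
    (M := (SchwartzMap.seminorm ℝ 0 0 g) ^ 2) fun x => ?_
  rw [norm_pow, norm_norm]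
  exact pow_le_pow_left₀ (norm_nonneg _) (g.norm_le_seminorm ℝ x) 2

theorem integrable_weight_mul_conj [NeZero n] {β : ℝ} (hβ0 : 0 < β) (hβn : β < n)
    (g : SchwartzMap (EuclideanSpace ℝ (Fin n)) ℂ) :
    Integrable fun x => ((‖x‖ ^ (-β) : ℝ) : ℂ) * conj (g x) := by
  have h := integrable_norm_rpow_neg_mul hβ0 hβn (g.integrable (μ := volume)).norm
    (M := SchwartzMap.seminorm ℝ 0 0 g) fun x => by
      rw [norm_norm]; exact g.norm_le_seminorm ℝ x
  have hg := g.continuous.measurable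
  refine h.mono' (Measurable.aestronglyMeasurable (by fun_prop)) (Eventually.of_forall fun x => ?_)
  rw [norm_mul, RCLike.norm_conj, Complex.norm_real, norm_of_nonneg (by positivity)]

theorem pittLHS_eq_lintegral [NeZero m] (f : SchwartzMap (Fin m → EuclideanSpace ℝ (Fin n)) ℂ)
    (β : ℝ) : pittLHS (fun x => f x) β =
      ∫⁻ x, ENNReal.ofReal (‖x‖ ^ (-β) * ‖diagTrace f x‖ ^ 2) := by
  refine lintegral_congr fun x => ?_
  rw [ENNReal.ofReal_mul (by positivity), ENNReal.ofReal_pow (norm_nonneg _), ofReal_norm]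
  rfl

theorem pittLHS_ne_top [NeZero m] [NeZero n] {β : ℝ} (hβ0 : 0 < β) (hβn : β < n)
    (f : SchwartzMap (Fin m → EuclideanSpace ℝ (Fin n)) ℂ) : pittLHS (fun x => f x) β ≠ ⊤ := by
  rw [pittLHS_eq_lintegral]
  have h := (integrable_weight_mul_norm_sq hβ0 hβn (diagTrace f)).2
  rw [hasFiniteIntegral_iff_ofReal (Eventually.of_forall fun _ => by positivity)] at h
  exact h.ne

theorem enorm_integral_diag_mul_weight [NeZero m] [NeZero n] {β : ℝ} (hβ0 : 0 < β) (hβn : β < n)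
    (f : SchwartzMap (Fin m → EuclideanSpace ℝ (Fin n)) ℂ) :
    ‖∫ x, f (fun _ => x) * (((‖x‖ ^ (-β) : ℝ) : ℂ) * conj (diagTrace f x))‖ₑ =
      pittLHS (fun x => f x) β := by
  have h : ∀ x : EuclideanSpace ℝ (Fin n),
      f (fun _ => x) * (((‖x‖ ^ (-β) : ℝ) : ℂ) * conj (diagTrace f x)) =
      ((‖x‖ ^ (-β) * ‖diagTrace f x‖ ^ 2 : ℝ) : ℂ) := by
    intro x
    rw [← diagTrace_apply, mul_left_comm, Complex.mul_conj']
    push_cast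
    rfl
  simp_rw [h]
  rw [integral_complex_ofReal, ← ofReal_norm, Complex.norm_real, norm_of_nonneg
    (integral_nonneg fun x => by positivity), pittLHS_eq_lintegral,
    ofReal_integral_eq_lintegral_ofReal (integrable_weight_mul_norm_sq hβ0 hβn _)
    (Eventually.of_forall fun _ => by positivity)]

theorem lintegral_weight_eq_pittLHS [NeZero m] [NeZero n] (β : ℝ)
    (f : SchwartzMap (Fin m → EuclideanSpace ℝ (Fin n)) ℂ) :
    ∫⁻ x, ENNReal.ofReal (‖x‖ ^ β * ‖((‖x‖ ^ (-β) : ℝ) : ℂ) * conj (diagTrace f x)‖ ^ 2) =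
      pittLHS (fun x => f x) β := by
  rw [pittLHS_eq_lintegral]
  refine lintegral_congr_ae ?_
  filter_upwards [Measure.ae_ne volume 0] with x hx0
  have hx := norm_pos_iff.2 hx0
  rw [norm_mul, RCLike.norm_conj, Complex.norm_real, norm_of_nonneg (by positivity), mul_pow,
    ← mul_assoc, ← rpow_mul_natCast hx.le, ← rpow_add hx]
  congr 3
  push_cast
  ring

theorem diagTrace_eq_zero_of_ae_eq [NeZero m] [NeZero n] {β : ℝ} (hβn : β < n)
    {f : SchwartzMap (Fin m → EuclideanSpace ℝ (Fin n)) ℂ} {c : ℝ}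
    (h : ∀ᵐ x, ‖((‖x‖ ^ (-β) : ℝ) : ℂ) * conj (diagTrace f x)‖ * ‖x‖ ^ ((n + β) / 2) = c) :
    diagTrace f = 0 := by
  have hpos : 0 < ((n : ℝ) - β) / 2 := by linarith
  have h1 : (fun x => ‖diagTrace f x‖ * ‖x‖ ^ (((n : ℝ) - β) / 2)) =ᵐ[volume] fun _ => c := by
    filter_upwards [h, Measure.ae_ne volume 0] with x hx hx0
    have hx' := norm_pos_iff.2 hx0
    rw [← hx, norm_mul, RCLike.norm_conj, Complex.norm_real, norm_of_nonneg (by positivity),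
      mul_right_comm, ← rpow_add hx', mul_comm]
    congr 2
    ring
  have hcont := (diagTrace f).continuous
  replace h1 : (fun x => ‖diagTrace f x‖ * ‖x‖ ^ (((n : ℝ) - β) / 2)) = fun _ => c :=
    (Continuous.ae_eq_iff_eq volume
    (hcont.norm.mul (continuous_norm.rpow_const fun _ => Or.inr hpos.le)) continuous_const).1 h1
  have hc : c = 0 := by
    simpa [zero_rpow hpos.ne'] using (congrFun h1 0).symm
  refine DFunLike.coe_injective ?_
  rw [← Continuous.ae_eq_iff_eq volume (diagTrace f).continuous
    (0 : SchwartzMap (EuclideanSpace ℝ (Fin n)) ℂ).continuous]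
  filter_upwards [Measure.ae_ne volume 0] with x hx0
  have : ‖diagTrace f x‖ * ‖x‖ ^ (((n : ℝ) - β) / 2) = c := congrFun h1 x
  rw [hc, mul_eq_zero, or_iff_left (rpow_pos_of_pos (norm_pos_iff.2 hx0) _).ne'] at this
  simpa using this

theorem LamM_ne_zero [NeZero n] (α : Fin m → ℝ)
    {f : SchwartzMap (Fin m → EuclideanSpace ℝ (Fin n)) ℂ} (hf : f ≠ 0) :
    LamM (fun x => f x) α ≠ 0 := by
  obtain ⟨F, hF⟩ := exists_schwartz_transform f
  intro h
  refine hf ?_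
  have hm := F.continuous.measurable
  rw [LamM_eq_lintegral hF, lintegral_eq_zero_iff (by fun_prop)] at h
  have hF0 : (F : (Fin m → EuclideanSpace ℝ (Fin n)) → ℂ) = fun _ => 0 := by
    rw [← Continuous.ae_eq_iff_eq volume F.continuous continuous_const]
    filter_upwards [h, ae_forall_ne_zero (m := m) (n := n)] with ξ hξ hξ0
    rw [Pi.zero_apply, mul_eq_zero, or_iff_right] at hξ
    · simpa using hξ
    · rw [Finset.prod_eq_zero_iff]
      rintro ⟨k, -, hk⟩
      rw [ENNReal.ofReal_eq_zero] at hk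
      exact (rpow_pos_of_pos (norm_pos_iff.2 (hξ0 k)) (α k)).not_ge hk
  ext x
  rw [hF.2 x, hF0]
  simp

/-- The multilinear Pitt inequality is strict for nonzero Schwartz functions. -/
theorem pittLHS_lt [NeZero m] [NeZero n] {α : Fin m → ℝ} (hα0 : ∀ k, 0 < α k)
    (hα : ∀ k, α k < n) {β : ℝ} (hβ0 : 0 < β) (hβn : β < n) (hβ : β - n = ∑ k, (α k - n))
    {f : SchwartzMap (Fin m → EuclideanSpace ℝ (Fin n)) ℂ} (hf : f ≠ 0) :
    pittLHS (fun x => f x) β < (∏ k, ENNReal.ofReal (fourierRieszConst n (α k))) *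
      ENNReal.ofReal (steinWeissConst n β) * LamM (fun x => f x) α := by
  set P := ∏ k, ENNReal.ofReal (fourierRieszConst n (α k)) with hP
  set N := ENNReal.ofReal (steinWeissConst n β) with hN
  have hP0 : P ≠ 0 := Finset.prod_ne_zero_iff.2 fun k _ =>
    (ENNReal.ofReal_pos.2 (fourierRieszConst_pos (hα0 k) (hα k))).ne'
  have hPt : P ≠ ⊤ := ENNReal.prod_ne_top fun _ _ => ENNReal.ofReal_ne_top
  have hN0 : N ≠ 0 := (ENNReal.ofReal_pos.2 (steinWeissConst_pos hβ0 hβn)).ne'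
  have hL0 := LamM_ne_zero α hf
  set A := pittLHS (fun x => f x) β with hA
  set L := LamM (fun x => f x) α with hL
  by_cases hA0 : A = 0
  · rw [hA0]
    exact pos_iff_ne_zero.2 (mul_ne_zero (mul_ne_zero hP0 hN0) hL0)
  have hAt : A ≠ ⊤ := pittLHS_ne_top hβ0 hβn f
  by_cases hLt : L = ⊤
  · rw [hLt, ENNReal.mul_top (mul_ne_zero hP0 hN0)]
    exact hAt.lt_top
  have hg0 : diagTrace f ≠ 0 := by
    intro h0
    refine hA0 ?_
    rw [hA, pittLHS_eq_lintegral, h0]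
    simp
  obtain ⟨F, hF⟩ := exists_schwartz_transform f
  have hφ := integrable_weight_mul_conj hβ0 hβn (diagTrace f)
  have hgm := (diagTrace f).continuous.measurable
  have hφm : Measurable fun x : EuclideanSpace ℝ (Fin n) =>
    ((‖x‖ ^ (-β) : ℝ) : ℂ) * conj (diagTrace f x) := by fun_prop
  have hsq := enorm_integral_diag_mul_sq_le hF α hφ
  rw [enorm_integral_diag_mul_weight hβ0 hβn] at hsq
  have hB := freqEnergy_le hα0 hα hβ hφm hφ
  have hE := rieszEnergy_lt_or_ae_eq hβ0 hβn hφm.norm (fun _ => norm_nonneg _)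
    (by rw [lintegral_weight_eq_pittLHS]; exact hAt)
  rw [lintegral_weight_eq_pittLHS] at hE
  rcases hE with hE | ⟨c, hc⟩
  · have hstrict : A ^ 2 < L * (P * (N * A)) :=
      (hsq.trans (mul_le_mul_right hB L)).trans_lt
        ((ENNReal.mul_lt_mul_iff_right hL0 hLt).2 ((ENNReal.mul_lt_mul_iff_right hP0 hPt).2 hE))
    rw [← ENNReal.mul_lt_mul_iff_right hA0 hAt]
    calc A * A = A ^ 2 := (sq A).symm
      _ < L * (P * (N * A)) := hstrict
      _ = A * (P * N * L) := by ring
  · exact absurd (diagTrace_eq_zero_of_ae_eq hβn hc) hg0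

/-- The measure `∏ ‖ξ k‖ ^ α k dξ`. -/
def freqMeasure (n : ℕ) (α : Fin m → ℝ) : Measure (Fin m → EuclideanSpace ℝ (Fin n)) :=
  volume.withDensity fun ξ => ∏ k, ENNReal.ofReal (‖ξ k‖ ^ α k)

theorem isLocallyFiniteMeasure_freqMeasure {α : Fin m → ℝ} (hα : ∀ k, 0 < α k) :
    IsLocallyFiniteMeasure (freqMeasure n α) := by
  have h : freqMeasure n α = volume.withDensity fun ξ =>
      ENNReal.ofReal (∏ k, ‖ξ k‖ ^ α k) := by
    unfold freqMeasure
    congr 1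
    ext ξ
    rw [ENNReal.ofReal_prod_of_nonneg fun k _ => by positivity]
  rw [h]
  refine IsLocallyFiniteMeasure.withDensity_ofReal ?_
  exact continuous_finsetProd _ fun k _ =>
    (continuous_norm.comp (continuous_apply k)).rpow_const fun _ => Or.inr (hα k).le

theorem eLpNorm_freqMeasure_sq (α : Fin m → ℝ) {G : (Fin m → EuclideanSpace ℝ (Fin n)) → ℂ}
    (hG : Measurable G) :
    eLpNorm G 2 (freqMeasure n α) ^ 2 =
      ∫⁻ ξ, (∏ k, ENNReal.ofReal (‖ξ k‖ ^ α k)) * ‖G ξ‖ₑ ^ 2 := by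
  rw [eLpNorm_eq_lintegral_rpow_enorm_toReal two_ne_zero ENNReal.ofNat_ne_top, ← ENNReal.rpow_two,
    ← ENNReal.rpow_mul]
  simp only [ENNReal.toReal_ofNat, ENNReal.rpow_two, one_div, ne_eq, OfNat.ofNat_ne_zero,
    not_false_eq_true, inv_mul_cancel₀, ENNReal.rpow_one]
  rw [freqMeasure, lintegral_withDensity_eq_lintegral_mul _ (by fun_prop) (by fun_prop)]
  rfl

/-- The extremal frequency profile dual to `φ`. -/
def dualProfile (α : Fin m → ℝ) (φ : EuclideanSpace ℝ (Fin n) → ℂ)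
    (ξ : Fin m → EuclideanSpace ℝ (Fin n)) : ℂ :=
  ((∏ k, ‖ξ k‖ ^ (-α k) : ℝ) : ℂ) * conj (𝓕 φ (∑ k, ξ k))

theorem measurable_dualProfile (α : Fin m → ℝ) {φ : EuclideanSpace ℝ (Fin n) → ℂ}
    (hφ : Integrable φ) : Measurable (dualProfile α φ) := by
  have hc := (continuous_fourier_of_integrable hφ).measurable
  unfold dualProfile
  fun_prop

theorem dualProfile_mul (α : Fin m → ℝ) (φ : EuclideanSpace ℝ (Fin n) → ℂ)
    (ξ : Fin m → EuclideanSpace ℝ (Fin n)) :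
    dualProfile α φ ξ * 𝓕 φ (∑ k, ξ k) =
      (((∏ k, ‖ξ k‖ ^ (-α k)) * ‖𝓕 φ (∑ k, ξ k)‖ ^ 2 : ℝ) : ℂ) := by
  rw [dualProfile, mul_assoc, Complex.conj_mul']
  push_cast
  rfl

theorem freqEnergy_eq_lintegral_ofReal (α : Fin m → ℝ) (φ : EuclideanSpace ℝ (Fin n) → ℂ) :
    freqEnergy α φ = ∫⁻ ξ : Fin m → EuclideanSpace ℝ (Fin n),
      ENNReal.ofReal ((∏ k, ‖ξ k‖ ^ (-α k)) * ‖𝓕 φ (∑ k, ξ k)‖ ^ 2) := by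
  refine lintegral_congr fun ξ => ?_
  rw [ENNReal.ofReal_mul (Finset.prod_nonneg fun k _ => by positivity),
    ENNReal.ofReal_prod_of_nonneg fun k _ => by positivity]

theorem eLpNorm_dualProfile_sq [NeZero n] (α : Fin m → ℝ) {φ : EuclideanSpace ℝ (Fin n) → ℂ}
    (hφ : Integrable φ) :
    eLpNorm (dualProfile α φ) 2 (freqMeasure n α) ^ 2 = freqEnergy α φ := by
  rw [eLpNorm_freqMeasure_sq α (measurable_dualProfile α hφ), freqEnergy]
  refine lintegral_congr_ae ?_
  filter_upwards [ae_forall_ne_zero (m := m) (n := n)] with ξ hξ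
  rw [dualProfile, enorm_mul, mul_pow, ← ofReal_norm, ← ofReal_norm, RCLike.norm_conj,
    Complex.norm_real, norm_of_nonneg (Finset.prod_nonneg fun k _ => by positivity), ← mul_assoc,
    ENNReal.ofReal_prod_of_nonneg fun k _ => by positivity, ← Finset.prod_pow,
    ← Finset.prod_mul_distrib, ENNReal.ofReal_pow (norm_nonneg _)]
  congr 1
  refine Finset.prod_congr rfl fun k _ => ?_
  have hk := norm_pos_iff.2 (hξ k)
  rw [← ENNReal.ofReal_pow (by positivity), ← ENNReal.ofReal_mul (by positivity),
    ← rpow_mul_natCast hk.le, ← rpow_add hk]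
  congr 2
  push_cast
  ring

theorem integrable_dualProfile_mul (α : Fin m → ℝ) {φ : EuclideanSpace ℝ (Fin n) → ℂ}
    (hφ : Integrable φ) (hB : freqEnergy α φ ≠ ⊤) :
    Integrable fun ξ : Fin m → EuclideanSpace ℝ (Fin n) =>
      (∏ k, ‖ξ k‖ ^ (-α k)) * ‖𝓕 φ (∑ k, ξ k)‖ ^ 2 := by
  have hc := (continuous_fourier_of_integrable hφ).measurable
  refine ⟨Measurable.aestronglyMeasurable (by fun_prop), ?_⟩
  rw [hasFiniteIntegral_iff_ofReal (Eventually.of_forall fun ξ =>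
    mul_nonneg (Finset.prod_nonneg fun k _ => by positivity) (by positivity)),
    ← freqEnergy_eq_lintegral_ofReal]
  exact hB.lt_top

theorem enorm_integral_dualProfile_mul (α : Fin m → ℝ) {φ : EuclideanSpace ℝ (Fin n) → ℂ}
    (hφ : Integrable φ) (hB : freqEnergy α φ ≠ ⊤) :
    ‖∫ ξ, dualProfile α φ ξ * 𝓕 φ (∑ k, ξ k)‖ₑ = freqEnergy α φ := by
  have h0 : ∀ ξ : Fin m → EuclideanSpace ℝ (Fin n),
      0 ≤ (∏ k, ‖ξ k‖ ^ (-α k)) * ‖𝓕 φ (∑ k, ξ k)‖ ^ 2 := fun ξ =>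
    mul_nonneg (Finset.prod_nonneg fun k _ => by positivity) (by positivity)
  simp_rw [dualProfile_mul]
  rw [integral_complex_ofReal, ← ofReal_norm, Complex.norm_real, norm_of_nonneg
    (integral_nonneg h0), freqEnergy_eq_lintegral_ofReal,
    ofReal_integral_eq_lintegral_ofReal (integrable_dualProfile_mul α hφ hB)
      (Eventually.of_forall h0)]

/-- The weighted Cauchy–Schwarz inequality on the physical side. -/
theorem enorm_integral_diag_mul_ofReal_sq_le [NeZero n]
    (f : SchwartzMap (Fin m → EuclideanSpace ℝ (Fin n)) ℂ) (β : ℝ)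
    {v : EuclideanSpace ℝ (Fin n) → ℝ} (hv : Measurable v) (hv0 : ∀ x, 0 ≤ v x) :
    ‖∫ x, f (fun _ => x) * (v x : ℂ)‖ₑ ^ 2 ≤
      pittLHS (fun x => f x) β * ∫⁻ x, ENNReal.ofReal (‖x‖ ^ β * v x ^ 2) := by
  have hf : Measurable fun x : EuclideanSpace ℝ (Fin n) => f fun _ => x :=
    (f.continuous.comp (by fun_prop)).measurable
  have hle : ‖∫ x, f (fun _ => x) * (v x : ℂ)‖ₑ ≤ ∫⁻ x : EuclideanSpace ℝ (Fin n),
      (ENNReal.ofReal (‖x‖ ^ (-β / 2)) * ‖f fun _ => x‖ₑ) *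
        (ENNReal.ofReal (‖x‖ ^ (β / 2)) * ENNReal.ofReal (v x)) := by
    refine (enorm_integral_le_lintegral_enorm _).trans_eq (lintegral_congr_ae ?_)
    filter_upwards [Measure.ae_ne volume 0] with x hx0
    have hx := norm_pos_iff.2 hx0
    rw [mul_mul_mul_comm, ← ENNReal.ofReal_mul (by positivity), ← rpow_add hx, neg_div,
      neg_add_cancel, rpow_zero, ENNReal.ofReal_one, one_mul, enorm_mul, ← ofReal_norm (v x : ℂ),
      Complex.norm_real, norm_of_nonneg (hv0 x)]
  refine (pow_le_pow_left' hle 2).trans ((lintegral_mul_sq_le (by fun_prop) (by fun_prop)).trans_eq ?_)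
  congr 1
  · refine lintegral_congr fun x => ?_
    rw [mul_pow, ofReal_rpow_half_sq _ _ (norm_nonneg _)]
    rfl
  · refine lintegral_congr fun x => ?_
    rw [mul_pow, ofReal_rpow_half_sq _ _ (norm_nonneg _), ENNReal.ofReal_mul (by positivity),
      ENNReal.ofReal_pow (hv0 x)]

theorem le_of_forall_mul_self_le {b s : ℝ≥0∞} (hb : b ≠ ⊤) (hs : s ≠ ⊤)
    (h : ∀ ε : ℝ, 0 < ε → b * b ≤ ENNReal.ofReal ε * b + s * (b + ENNReal.ofReal ε)) : b ≤ s := by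
  have hlim : Tendsto (fun ε : ℝ => s * b + ENNReal.ofReal ε * (b + s)) (𝓝[>] 0)
      (𝓝 (s * b + ENNReal.ofReal 0 * (b + s))) := by
    refine tendsto_const_nhds.add (ENNReal.Tendsto.mul_const ?_
      (Or.inr (ENNReal.add_ne_top.2 ⟨hb, hs⟩)))
    exact (ENNReal.continuous_ofReal.tendsto 0).mono_left nhdsWithin_le_nhds
  have hle : b * b ≤ s * b := by
    have := ge_of_tendsto (b := b * b) hlim (by
      filter_upwards [self_mem_nhdsWithin] with ε hε
      refine (h ε hε).trans_eq ?_
      ring)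
    simpa using this
  by_cases hb0 : b = 0
  · rw [hb0]; exact zero_le
  · rw [mul_comm s b] at hle
    exact (ENNReal.mul_le_mul_iff_right hb0 hb).1 hle

/-- Any admissible constant in the trace inequality is admissible in the dual inequality. -/
theorem freqEnergy_le_of_pitt [NeZero m] [NeZero n] {α : Fin m → ℝ} (hα : ∀ k, 0 < α k) {β : ℝ}
    {C : ℝ≥0∞} (hC : C ≠ ⊤)
    (h : ∀ f : SchwartzMap (Fin m → EuclideanSpace ℝ (Fin n)) ℂ,
      pittLHS (fun x => f x) β ≤ C * LamM (fun x => f x) α)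
    {v : EuclideanSpace ℝ (Fin n) → ℝ} (hv : Measurable v) (hv0 : ∀ x, 0 ≤ v x)
    (hvi : Integrable v) (hD : ∫⁻ x, ENNReal.ofReal (‖x‖ ^ β * v x ^ 2) ≠ ⊤)
    (hB : freqEnergy α (fun x => (v x : ℂ)) ≠ ⊤) :
    freqEnergy α (fun x => (v x : ℂ)) ≤ C * ∫⁻ x, ENNReal.ofReal (‖x‖ ^ β * v x ^ 2) := by
  set φ : EuclideanSpace ℝ (Fin n) → ℂ := fun x => (v x : ℂ) with hφdef
  have hφ : Integrable φ := hvi.ofReal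
  set D := ∫⁻ x, ENNReal.ofReal (‖x‖ ^ β * v x ^ 2) with hDdef
  have := isLocallyFiniteMeasure_freqMeasure (n := n) hα
  set K := dualProfile α φ with hK
  set b := eLpNorm K 2 (freqMeasure n α) with hb
  have hbsq : b ^ 2 = freqEnergy α φ := eLpNorm_dualProfile_sq α hφ
  have hbt : b ≠ ⊤ := by
    intro htop
    rw [htop] at hbsq
    exact hB (hbsq.symm.trans (by simp))
  have hKm : Measurable K := measurable_dualProfile α hφ
  set s := (C * D) ^ (1 / 2 : ℝ) with hs
  have hssq : s ^ 2 = C * D := by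
    rw [hs, ← ENNReal.rpow_two, ← ENNReal.rpow_mul]
    norm_num
  have hst : s ≠ ⊤ := ENNReal.rpow_ne_top_of_nonneg (by norm_num) (ENNReal.mul_ne_top hC hD)
  rw [← hbsq, ← hssq]
  refine pow_le_pow_left' (le_of_forall_mul_self_le hbt hst fun ε hε => ?_) 2
  obtain ⟨G, hGs, hGd, hGε⟩ := MemLp.exist_eLpNorm_sub_le (p := 2) ENNReal.ofNat_ne_top one_le_two
    (⟨hKm.aestronglyMeasurable, hbt.lt_top⟩ : MemLp K 2 (freqMeasure n α)) hε
  set F := hGs.toSchwartzMap hGd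
  have hFG : (F : (Fin m → EuclideanSpace ℝ (Fin n)) → ℂ) = G := rfl
  have hGm : Measurable G := hGd.continuous.measurable
  obtain ⟨f, hf⟩ := exists_schwartz_preimage F
  have hc := continuous_fourier_of_integrable hφ
  have hFint : Integrable fun ξ => G ξ * 𝓕 φ (∑ k, ξ k) := by
    refine (F.integrable (μ := volume)).mul_bdd (c := ∫ x, ‖φ x‖) (by fun_prop)
      (Eventually.of_forall fun ξ => norm_fourier_le_integral_norm φ _)
  have hKint : Integrable fun ξ => K ξ * 𝓕 φ (∑ k, ξ k) := by
    simp_rw [hK, dualProfile_mul]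
    exact (integrable_dualProfile_mul α hφ hB).ofReal
  have hpair : ‖∫ ξ, G ξ * 𝓕 φ (∑ k, ξ k)‖ₑ ≤ s * (b + ENNReal.ofReal ε) := by
    have hnorm : eLpNorm G 2 (freqMeasure n α) ≤ b + ENNReal.ofReal ε := by
      have : G = K - (K - G) := by simp
      rw [this]
      exact (eLpNorm_sub_le hKm.aestronglyMeasurable (hKm.sub hGm).aestronglyMeasurable
        one_le_two).trans (add_le_add_right hGε b)
    refine le_trans ?_ (mul_le_mul_right hnorm s)
    rw [← ENNReal.pow_le_pow_left_iff two_ne_zero, mul_pow, hssq, eLpNorm_freqMeasure_sq α hGm,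
      ← hFG, ← LamM_eq_lintegral hf, ← integral_diag_mul hf hφ]
    refine (enorm_integral_diag_mul_ofReal_sq_le f β hv hv0).trans ?_
    rw [mul_right_comm]
    exact mul_le_mul_left (h f) D
  have hdiff : ‖∫ ξ, (K - G) ξ * 𝓕 φ (∑ k, ξ k)‖ₑ ≤ ENNReal.ofReal ε * b := by
    refine le_trans ?_ (mul_le_mul_left hGε b)
    rw [← ENNReal.pow_le_pow_left_iff two_ne_zero, mul_pow, hbsq,
      eLpNorm_freqMeasure_sq α (hKm.sub hGm)]
    exact (pow_le_pow_left' (enorm_integral_le_lintegral_enorm _) 2).trans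
      (lintegral_enorm_mul_sq_le α (hKm.sub hGm) hφ)
  rw [← sq, hbsq, ← enorm_integral_dualProfile_mul α hφ hB]
  have hsplit : ∫ ξ, K ξ * 𝓕 φ (∑ k, ξ k) =
      (∫ ξ, (K - G) ξ * 𝓕 φ (∑ k, ξ k)) + ∫ ξ, G ξ * 𝓕 φ (∑ k, ξ k) := by
    rw [← integral_add _ hFint]
    · refine integral_congr_ae (Eventually.of_forall fun ξ => ?_)
      simp only [Pi.sub_apply]
      ring
    · simp only [Pi.sub_apply, sub_mul]
      exact hKint.sub hFint
  rw [hsplit]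
  exact (enorm_add_le _ _).trans (add_le_add hdiff hpair)

/-- Sharpness of the constant in the multilinear Pitt inequality. -/
theorem le_of_forall_pittLHS_le [NeZero m] [NeZero n] {α : Fin m → ℝ} (hα0 : ∀ k, 0 < α k)
    (hα : ∀ k, α k < n) {β : ℝ} (hβ0 : 0 < β) (hβn : β < n) (hβ : β - n = ∑ k, (α k - n))
    {C : ℝ≥0∞} (h : ∀ f : SchwartzMap (Fin m → EuclideanSpace ℝ (Fin n)) ℂ,
      pittLHS (fun x => f x) β ≤ C * LamM (fun x => f x) α) :
    (∏ k, ENNReal.ofReal (fourierRieszConst n (α k))) * ENNReal.ofReal (steinWeissConst n β) ≤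
      C := by
  refine ENNReal.le_of_forall_pos_le_add fun ε hε hC => ?_
  have hPt : (∏ k, ENNReal.ofReal (fourierRieszConst n (α k))) ≠ ⊤ :=
    ENNReal.prod_ne_top fun _ _ => ENNReal.ofReal_ne_top
  refine mul_steinWeissConst_le hβ0 hβn hPt fun v hv hv0 hvi => ?_
  by_cases hD : ∫⁻ x, ENNReal.ofReal (‖x‖ ^ β * v x ^ 2) = ⊤
  · rw [hD, ENNReal.mul_top (by positivity)]
    exact le_top
  have hB := freqEnergy_ofReal hα0 hα hβ hv hv0 hvi
  rw [← hB]
  refine freqEnergy_le_of_pitt hα0 (ENNReal.add_ne_top.2 ⟨hC.ne, ENNReal.coe_ne_top⟩)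
    (fun f => (h f).trans (mul_le_mul_left le_self_add _)) hv hv0 hvi hD ?_
  rw [hB]
  exact ENNReal.mul_ne_top hPt (ne_top_of_le_ne_top (ENNReal.mul_ne_top ENNReal.ofReal_ne_top hD)
    (rieszEnergy_le hβ0 hβn hv hv0))

theorem steinWeissConst_eq (n : ℕ) (β : ℝ) :
    steinWeissConst n β = π ^ (n / 2 : ℝ) * (Gamma (β / 2) / Gamma ((n - β) / 2)) *
      (Gamma ((n - β) / 4) / Gamma ((n + β) / 4)) ^ 2 := by
  rw [steinWeissConst, rieszConst, show ((n : ℝ) - (n + β) / 2) / 2 = (n - β) / 4 by ring,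
    show ((n : ℝ) - (n - β)) / 2 = β / 2 by ring,
    show (((n : ℝ) + β) / 2 + (n - β) - n) / 2 = (n - β) / 4 by ring,
    show ((n : ℝ) + β) / 2 / 2 = (n + β) / 4 by ring,
    show (2 * (n : ℝ) - (n + β) / 2 - (n - β)) / 2 = (n + β) / 4 by ring]
  simp only [div_eq_mul_inv, mul_inv]
  ring

/-- The explicit form of the sharp constant. -/
theorem prod_fourierRieszConst_mul_steinWeissConst (α : Fin m → ℝ) (β : ℝ) :
    (∏ k, fourierRieszConst n (α k)) * steinWeissConst n β =
      π ^ (-((m : ℝ) - 1) * n / 2 + ∑ k, α k) *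
      (∏ k, Gamma ((n - α k) / 2) / Gamma (α k / 2)) *
      (Gamma (β / 2) / Gamma ((n - β) / 2)) *
      (Gamma ((n - β) / 4) / Gamma ((n + β) / 4)) ^ 2 := by
  have hπ : π ^ (-((m : ℝ) - 1) * n / 2 + ∑ k, α k) =
      (∏ k, π ^ (α k - n / 2)) * π ^ (n / 2 : ℝ) := by
    rw [← rpow_sum_of_pos pi_pos, ← rpow_add pi_pos, Finset.sum_sub_distrib]
    congr 1
    simp only [Finset.sum_const, Finset.card_univ, Fintype.card_fin, nsmul_eq_mul]
    ring
  rw [steinWeissConst_eq, hπ]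
  simp only [fourierRieszConst, Finset.prod_mul_distrib]
  ring

end Auxiliary

/-- **Sharpness and absence of extremals in the multilinear Pitt inequality.**
`C_β` is the least constant in the inequality, and for every nonzero Schwartz `f`
the inequality is strict. -/
theorem stmt5 (m n : ℕ) (hm : 1 ≤ m) (hn : 1 ≤ n)
    (α : Fin m → ℝ) (hα : ∀ k, 0 < α k ∧ α k < n)
    (hlow : ((m : ℝ) - 1) * n < ∑ k, α k) (hhigh : (∑ k, α k) < m * n)
    (β : ℝ) (hβ : β = (∑ k, α k) - ((m : ℝ) - 1) * n)
    (Cβ : ℝ)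
    (hCβ : Cβ = Real.pi ^ (-((m : ℝ) - 1) * n / 2 + ∑ k, α k) *
      (∏ k, Real.Gamma (((n : ℝ) - α k) / 2) / Real.Gamma (α k / 2)) *
      (Real.Gamma (β / 2) / Real.Gamma (((n : ℝ) - β) / 2)) *
      (Real.Gamma (((n : ℝ) - β) / 4) / Real.Gamma (((n : ℝ) + β) / 4)) ^ 2) :
    IsLeast {C : ℝ≥0∞ |
        ∀ f : SchwartzMap (Fin m → EuclideanSpace ℝ (Fin n)) ℂ,
          pittLHS (fun x => f x) β ≤ C * LamM (fun x => f x) α}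
      (ENNReal.ofReal Cβ) ∧
    ∀ f : SchwartzMap (Fin m → EuclideanSpace ℝ (Fin n)) ℂ, f ≠ 0 →
      pittLHS (fun x => f x) β < ENNReal.ofReal Cβ * LamM (fun x => f x) α := by
  have : NeZero m := ⟨by omega⟩
  have : NeZero n := ⟨by omega⟩
  have hα0 : ∀ k, 0 < α k := fun k => (hα k).1
  have hαn : ∀ k, α k < n := fun k => (hα k).2
  have hβ0 : 0 < β := by linarith
  have hβn : β < n := by linarith
  have hβsum : β - n = ∑ k, (α k - n) := by
    rw [hβ, Finset.sum_sub_distrib]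
    simp only [Finset.sum_const, Finset.card_univ, Fintype.card_fin, nsmul_eq_mul]
    ring
  have hC : ENNReal.ofReal Cβ = (∏ k, ENNReal.ofReal (fourierRieszConst n (α k))) *
      ENNReal.ofReal (steinWeissConst n β) := by
    have hpos : ∀ k, 0 ≤ fourierRieszConst n (α k) := fun k =>
      (fourierRieszConst_pos (hα0 k) (hαn k)).le
    rw [hCβ, ← prod_fourierRieszConst_mul_steinWeissConst,
      ENNReal.ofReal_mul (Finset.prod_nonneg fun k _ => hpos k),
      ENNReal.ofReal_prod_of_nonneg fun k _ => hpos k]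
  rw [hC]
  refine ⟨⟨fun f => ?_, fun C h => le_of_forall_pittLHS_le hα0 hαn hβ0 hβn hβsum h⟩,
    fun f hf => pittLHS_lt hα0 hαn hβ0 hβn hβsum hf⟩
  by_cases hf : f = 0
  · simp [hf, pittLHS]
  · exact (pittLHS_lt hα0 hαn hβ0 hβn hβsum hf).le
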